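/- arXiv:0712.3584 — 2 statements merged into one kernel-verified Lean document; each statement's English description precedes it below -/
import Mathlib

section
/- Let τ be an indeterminate and for integers n, i, j with n + i ≥ 2, i ≤ −1 and j − n − i ≥ 1, set f(n,i,j) := T(n+j, n+i, j−n−i) ∈ ℤ[τ]. Then f satisfies the discrete Hirota (octahedron) equation: f(n,i,j)·f(n−2,i,j) = f(n−1,i−1,j)·f(n−1,i+1,j) + τ²·f(n−1,i,j−1)·f(n−1,i,j+1). -/
open Polynomial Finset

/-- Binomial coefficient `C(a,b)` for integer arguments, equal to `0` if `b < 0` or `b > a`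
    (for `a ≥ 0`). -/
def intChoose (a b : ℤ) : ℤ := if 0 ≤ b then (a.toNat.choose b.toNat : ℤ) else 0

/-- `T(L,p,k)`: the determinant of the `p × p` matrix whose `(ℓ,m)` entry (`1 ≤ ℓ, m ≤ p`) is
    `∑_{r=0}^{2p} C(ℓ+k-1, r-ℓ) C(m+L-2p-k, 2m-r) τ^{2(2m-r)}`, as a polynomial in `τ`. -/
noncomputable def Tpoly (L p k : ℤ) : Polynomial ℤ :=
  Matrix.det (Matrix.of fun ℓ m : Fin p.toNat =>
    ∑ r ∈ Finset.range (2 * p.toNat + 1),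
      Polynomial.C (intChoose ((ℓ : ℤ) + 1 + k - 1) ((r : ℤ) - ((ℓ : ℤ) + 1)) *
          intChoose (((m : ℤ) + 1) + L - 2 * p - k) (2 * ((m : ℤ) + 1) - (r : ℤ))) *
        Polynomial.X ^ (2 * (2 * ((m : ℤ) + 1) - (r : ℤ))).toNat)

namespace Matrix

variable {R : Type*} [CommRing R]

/-- The Desnanot–Jacobi identity multiplied by `M.det`: compare determinants in the product of `M`
and the identity matrix whose first and last columns are replaced by those of the adjugate. -/
theorem det_mul_desnanot_jacobi {n : ℕ} (M : Matrix (Fin (n + 2)) (Fin (n + 2)) R) :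
    M.det * (M.det * (M.submatrix (fun i : Fin n => i.castSucc.succ)
        (fun i : Fin n => i.castSucc.succ)).det) =
      M.det * ((M.submatrix Fin.succ Fin.succ).det * (M.submatrix Fin.castSucc Fin.castSucc).det -
        (M.submatrix Fin.succ Fin.castSucc).det * (M.submatrix Fin.castSucc Fin.succ).det) := by
  set l : Fin (n + 2) := Fin.last (n + 1) with hl
  have h0l : (0 : Fin (n + 2)) ≠ l := (Fin.last_pos).ne
  let δ : Fin (n + 2) → Fin (n + 2) → R := fun i j => if i = j then 1 else 0
  let u : Fin (n + 2) → Fin (n + 2) → R := fun k i => M.adjugate i k - δ i k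
  let U : Matrix (Fin (n + 2)) (Fin 2) R := of fun i c => ![u 0 i, u l i] c
  let V : Matrix (Fin 2) (Fin (n + 2)) R := of fun c j => ![δ j 0, δ j l] c
  have hdet : (1 + U * V).det =
      (M.submatrix Fin.succ Fin.succ).det * (M.submatrix Fin.castSucc Fin.castSucc).det -
        (M.submatrix Fin.succ Fin.castSucc).det * (M.submatrix Fin.castSucc Fin.succ).det := by
    have hVU : 1 + V * U = !![M.adjugate 0 0, M.adjugate 0 l; M.adjugate l 0, M.adjugate l l] := by
      ext c d
      rw [add_apply, Matrix.mul_apply]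
      fin_cases c <;> fin_cases d <;> simp [V, U, u, δ, h0l, h0l.symm]
    rw [det_one_add_mul_comm, hVU, det_fin_two_of]
    simp only [adjugate_fin_succ_eq_det_submatrix, hl,
      Fin.succAbove_last, Fin.succAbove_zero, Fin.val_zero, Fin.val_last]
    have hs : ((-1 : R) ^ (n + 1)) * (-1) ^ (n + 1) = 1 := by
      rw [← mul_pow]; simp
    have hs' : ((-1 : R) ^ (n + 1 + (n + 1))) = 1 := by rw [pow_add, hs]
    simp only [add_zero, zero_add, pow_zero, hs']
    linear_combination (-(M.submatrix Fin.succ Fin.castSucc).det *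
      (M.submatrix Fin.castSucc Fin.succ).det) * hs
  have hcol : ∀ i j, (M * (1 + U * V) : Matrix (Fin (n + 2)) (Fin (n + 2)) R) i j =
      if j = 0 then M.det * δ i 0 else if j = l then M.det * δ i l else M i j := by
    intro i j
    have hu : ∀ k, ∑ m, M i m * u k m = M.det * δ i k - M i k := by
      intro k
      have hadj := congrFun (congrFun (mul_adjugate M) i) k
      rw [Matrix.mul_apply, smul_apply, one_apply, smul_eq_mul] at hadj
      simp only [u, mul_sub, Finset.sum_sub_distrib, hadj]
      simp [δ]
    have hMU : (M * (1 + U * V) : Matrix (Fin (n + 2)) (Fin (n + 2)) R) i j =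
        M i j + ((M.det * δ i 0 - M i 0) * δ j 0 + (M.det * δ i l - M i l) * δ j l) := by
      rw [mul_add, mul_one, ← Matrix.mul_assoc, add_apply, Matrix.mul_apply, Fin.sum_univ_two,
        Matrix.mul_apply, Matrix.mul_apply, ← hu, ← hu]
      simp [U, V]
    rw [hMU]
    split_ifs with h h'
    · subst h
      simp [δ, h0l]
    · subst h'
      simp [δ, h0l.symm]
    · simp [δ, h, h']
  have hprod : (M * (1 + U * V)).det = M.det * (M.det *
      (M.submatrix (fun i : Fin n => i.castSucc.succ) (fun i : Fin n => i.castSucc.succ)).det) := by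
    rw [det_succ_column_zero, Fin.sum_univ_succ, Finset.sum_eq_zero, add_zero]
    · rw [det_succ_column _ (Fin.last n), Fin.sum_univ_castSucc, Finset.sum_eq_zero, zero_add]
      · have hsub : ((M * (1 + U * V)).submatrix (Fin.succAbove 0) Fin.succ).submatrix
            (Fin.last n).succAbove (Fin.last n).succAbove =
            M.submatrix (fun i : Fin n => i.castSucc.succ) (fun i : Fin n => i.castSucc.succ) := by
          ext i j
          have : j.castSucc.succ ≠ l := by
            simp [hl, Fin.ext_iff, j.isLt.ne]
          simp only [submatrix_apply, hcol, Fin.succAbove_last, Fin.succAbove_zero]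
          rw [if_neg (Fin.succ_ne_zero _), if_neg this]
        have hs : ((-1 : R) ^ (n + n)) = 1 := by rw [← two_mul, pow_mul]; simp
        rw [hsub]
        simp [hcol, hl, hs, δ]
      · intro i _
        have : i.castSucc.succ ≠ l := by
          simp [hl, Fin.ext_iff, i.isLt.ne]
        simp [hcol, hl, δ, i.isLt.ne, Fin.ext_iff]
    · intro i _
      simp [hcol, δ]
  rw [← hdet, ← det_mul, hprod]

/-- The **Desnanot–Jacobi identity** (Dodgson condensation). -/
theorem desnanot_jacobi {n : ℕ} (M : Matrix (Fin (n + 2)) (Fin (n + 2)) R) :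
    M.det * (M.submatrix (fun i : Fin n => i.castSucc.succ)
        (fun i : Fin n => i.castSucc.succ)).det =
      (M.submatrix Fin.succ Fin.succ).det * (M.submatrix Fin.castSucc Fin.castSucc).det -
        (M.submatrix Fin.succ Fin.castSucc).det * (M.submatrix Fin.castSucc Fin.succ).det := by
  have h := mul_left_cancel₀ (det_mvPolynomialX_ne_zero (Fin (n + 2)) ℤ)
    (det_mul_desnanot_jacobi (mvPolynomialX (Fin (n + 2)) (Fin (n + 2)) ℤ))
  have hM : (mvPolynomialX (Fin (n + 2)) (Fin (n + 2)) ℤ).map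
      (MvPolynomial.eval₂Hom (Int.castRingHom R) fun p : Fin (n + 2) × Fin (n + 2) => M p.1 p.2) =
      M := by
    ext i j
    simp
  replace h := congrArg
    (MvPolynomial.eval₂Hom (Int.castRingHom R) fun p : Fin (n + 2) × Fin (n + 2) => M p.1 p.2) h
  simp only [map_mul, map_sub, RingHom.map_det, RingHom.mapMatrix_apply, ← submatrix_map, hM] at h
  exact h

/-- Adding multiples of the next rows to each row does not change the determinant. -/
theorem det_eq_of_forall_row_eq_smul_add_succ {n : ℕ}
    {A B : Matrix (Fin (n + 1)) (Fin (n + 1)) R} (c : R)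
    (h_last : ∀ j, A (Fin.last n) j = B (Fin.last n) j)
    (h_castSucc : ∀ (i : Fin n) (j), A i.castSucc j = B i.castSucc j + c * A i.succ j) :
    A.det = B.det := by
  rw [← det_submatrix_equiv_self Fin.revPerm A, ← det_submatrix_equiv_self Fin.revPerm B]
  refine det_eq_of_forall_row_eq_smul_add_pred (fun _ => c) (fun j => ?_) fun i j => ?_
  · simp [h_last]
  · simp [Fin.rev_succ, Fin.rev_castSucc, h_castSucc]

end Matrix

section Plucker

variable {R : Type*} [CommRing R]

open Matrix

/-- Here `e` is bordered by a column which `e_i ↦ e_i + t e_{i+1}` annihilates except in the last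
row. -/
theorem det_cons_alternating (e : ℕ → ℕ → R) (s t : R) (n : ℕ) :
    (of fun i j : Fin (n + 1) => (Fin.cons (s * (-1) ^ (i : ℕ) * t ^ (n - i : ℕ))
        (fun k : Fin n => e i k) : Fin (n + 1) → R) j).det =
      s * (of fun i j : Fin n => e i j + t * e (i + 1) j).det := by
  set A : Matrix (Fin (n + 1)) (Fin (n + 1)) R :=
    of fun i j => (Fin.cons (s * (-1) ^ (i : ℕ) * t ^ (n - i : ℕ))
      (fun k : Fin n => e i k) : Fin (n + 1) → R) j with hA
  have hAB : A.det = (of fun i j => Fin.lastCases (motive := fun _ => R) (A (Fin.last n) j)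
      (fun k : Fin n => A k.castSucc j + t * A k.succ j) i).det := by
    refine det_eq_of_forall_row_eq_smul_add_succ (-t) (fun j => by simp) fun i j => ?_
    simp
  rw [hAB, det_succ_column_zero, Fin.sum_univ_castSucc, Finset.sum_eq_zero, zero_add]
  · have hs : ((-1 : R) ^ n) * (s * (-1) ^ n) = s := by
      rw [mul_left_comm, ← mul_pow]; simp
    simp only [of_apply, Fin.lastCases_last, hA, Fin.cons_zero, Fin.val_last, Nat.sub_self,
      pow_zero, mul_one, hs]
    congr 2
    ext i j
    simp [Fin.succAbove_last]
  · intro i _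
    obtain ⟨m, hm⟩ : ∃ m, n = i + 1 + m := ⟨n - (i + 1), by omega⟩
    have h1 : n - (i : ℕ) = m + 1 := by omega
    have h2 : n - ((i : ℕ) + 1) = m := by omega
    simp only [of_apply, Fin.lastCases_castSucc, hA, Fin.cons_zero, Fin.val_castSucc,
      Fin.val_succ, h1, h2]
    ring

/-- A Plücker-type relation between minors of `e` and of `(a, b) ↦ e a b + t * e (a + 1) b`. -/
theorem det_add_succ_row_plucker (e : ℕ → ℕ → R) (t : R) (n : ℕ) :
    (of fun i j : Fin (n + 1) => e i j + t * e (i + 1) j).det *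
        (of fun i j : Fin n => e (i + 1) j).det =
      (of fun i j : Fin n => e (i + 1) j + t * e (i + 2) j).det *
          (of fun i j : Fin (n + 1) => e i j).det +
        t * ((of fun i j : Fin n => e i j + t * e (i + 1) j).det *
          (of fun i j : Fin (n + 1) => e (i + 1) j).det) := by
  set M : Matrix (Fin (n + 2)) (Fin (n + 2)) R :=
    of fun i j => (Fin.cons ((-1) ^ (i : ℕ) * t ^ (n + 1 - i : ℕ))
      (fun k : Fin (n + 1) => e i k) : Fin (n + 2) → R) j with hM
  have h := desnanot_jacobi M
  have h00 : M.submatrix Fin.succ Fin.succ = of fun i j : Fin (n + 1) => e (i + 1) j := by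
    ext i j; simp [hM]
  have h01 : M.submatrix Fin.castSucc Fin.succ = of fun i j : Fin (n + 1) => e i j := by
    ext i j; simp [hM]
  have hin : M.submatrix (fun i : Fin n => i.castSucc.succ) (fun i : Fin n => i.castSucc.succ) =
      of fun i j : Fin n => e (i + 1) j := by
    ext i j; simp [hM]
  have h10 : (M.submatrix Fin.succ Fin.castSucc).det =
      -(of fun i j : Fin n => e (i + 1) j + t * e (i + 2) j).det := by
    rw [← neg_one_mul, ← det_cons_alternating (fun a b => e (a + 1) b) (-1) t n]
    congr 1
    ext i j
    refine Fin.cases ?_ (fun j => ?_) j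
    · simp [hM, pow_succ]
    · simp [hM]
  have h11 : (M.submatrix Fin.castSucc Fin.castSucc).det =
      t * (of fun i j : Fin n => e i j + t * e (i + 1) j).det := by
    rw [← det_cons_alternating e t t n]
    congr 1
    ext i j
    refine Fin.cases ?_ (fun j => ?_) j
    · have hi : n + 1 - (i : ℕ) = n - i + 1 := by omega
      simp only [hM, submatrix_apply, of_apply, Fin.castSucc_zero, Fin.cons_zero,
        Fin.val_castSucc, hi]
      ring
    · simp [hM]
  have hdet : M.det = (of fun i j : Fin (n + 1) => e i j + t * e (i + 1) j).det := by
    simpa [hM] using det_cons_alternating e 1 t (n + 1)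
  rw [h00, h01, hin, h10, h11, hdet] at h
  rw [h]
  ring

end Plucker

section Bimoment

variable {R : Type*} [CommRing R]

/-- The pairing of `u ^ a` with `y ^ b`, where `u = X (1 + X)` and `y = (1 + t X) / X ^ 2`, against
the weight `(1 + X) ^ K (1 + t X) ^ q φ`. -/
noncomputable def bimoment (t : R) (φ : PowerSeries R) (K q a b : ℕ) : R :=
  PowerSeries.coeff (2 * b)
    (PowerSeries.X ^ a * ((1 + PowerSeries.X) ^ (a + K) *
      (1 + PowerSeries.C t * PowerSeries.X) ^ (b + q) * φ))

theorem bimoment_of_lt (t : R) (φ : PowerSeries R) (K q : ℕ) {a b : ℕ} (h : 2 * b < a) :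
    bimoment t φ K q a b = 0 := by
  rw [bimoment, PowerSeries.coeff_X_pow_mul', if_neg (by omega)]

theorem bimoment_two_mul (t : R) {φ : PowerSeries R} (hφ : PowerSeries.constantCoeff φ = 1)
    (K q b : ℕ) : bimoment t φ K q (2 * b) b = 1 := by
  rw [bimoment, PowerSeries.coeff_X_pow_mul', if_pos le_rfl]
  simp [hφ]

theorem bimoment_add_two (t : R) (φ : PowerSeries R) (K q a b : ℕ) :
    bimoment t φ K q (a + 2) (b + 1) = bimoment t φ (K + 2) (q + 1) a b := by
  rw [bimoment, bimoment, ← PowerSeries.coeff_X_pow_mul _ 2 (2 * b)]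
  congr 1
  ring

/-- `φ` inverts `1 + t u = 1 + t X + t X ^ 2`. -/
theorem bimoment_add_row {t : R} {φ : PowerSeries R}
    (hφ : φ * (1 + PowerSeries.C t * (PowerSeries.X * (1 + PowerSeries.X))) = 1) (K q a b : ℕ) :
    bimoment t φ K q a b + t * bimoment t φ K q (a + 1) b = bimoment t 1 K q a b := by
  simp only [bimoment]
  rw [← PowerSeries.coeff_C_mul, ← map_add]
  congr 1
  linear_combination (PowerSeries.X ^ a * ((1 + PowerSeries.X) ^ (a + K) *
      (1 + PowerSeries.C t * PowerSeries.X) ^ (b + q))) * hφ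

theorem bimoment_add_col {t : R} {φ : PowerSeries R}
    (hφ : φ * (1 + PowerSeries.C t * (PowerSeries.X * (1 + PowerSeries.X))) = 1) (K q a b : ℕ) :
    bimoment t φ K (q + 1) a (b + 1) + t * bimoment t φ K (q + 1) a b =
      bimoment t 1 K q a (b + 1) := by
  simp only [bimoment]
  rw [← PowerSeries.coeff_X_pow_mul _ 2 (2 * b), ← PowerSeries.coeff_C_mul,
    show 2 * b + 2 = 2 * (b + 1) by ring, ← map_add]
  congr 1
  linear_combination (PowerSeries.X ^ a * ((1 + PowerSeries.X) ^ (a + K) *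
      (1 + PowerSeries.C t * PowerSeries.X) ^ (b + 1 + q))) * hφ

open Matrix

/-- The bimoment determinant whose index shifts are `r` for rows and `c` for columns. -/
noncomputable def bimomentDet (t : R) (φ : PowerSeries R) (K q r c n : ℕ) : R :=
  (of fun i j : Fin n => bimoment t φ K q (i + r) (j + c)).det

theorem bimomentDet_add_two (t : R) (φ : PowerSeries R) (K q r c n : ℕ) :
    bimomentDet t φ K q (r + 2) (c + 1) n = bimomentDet t φ (K + 2) (q + 1) r c n := by
  simp only [bimomentDet, ← add_assoc, bimoment_add_two]

/-- The first column of the left-hand matrix is the first unit vector. -/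
theorem bimomentDet_two_mul (t : R) {φ : PowerSeries R} (hφ : PowerSeries.constantCoeff φ = 1)
    (K q c n : ℕ) :
    bimomentDet t φ K q (2 * c) c (n + 1) = bimomentDet t φ K q (2 * c + 1) (c + 1) n := by
  rw [bimomentDet, det_succ_column_zero, Fin.sum_univ_succ, Finset.sum_eq_zero, add_zero]
  · simp only [of_apply, Fin.val_zero, zero_add, pow_zero, one_mul, bimoment_two_mul t hφ,
      bimomentDet]
    congr 1
    ext i j
    simp only [submatrix_apply, of_apply, Fin.succAbove_zero, Fin.val_succ]
    congr 1 <;> omega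
  · intro i _
    simp only [of_apply, Fin.val_zero, zero_add, Fin.val_succ]
    rw [bimoment_of_lt t φ K q (by omega)]
    ring

theorem bimomentDet_one_eq {t : R} {φ : PowerSeries R}
    (hφ : φ * (1 + PowerSeries.C t * (PowerSeries.X * (1 + PowerSeries.X))) = 1)
    (K q c n : ℕ) {r : ℕ} (hr : 2 * c < r) :
    bimomentDet t 1 K q r (c + 1) n = bimomentDet t φ K (q + 1) r (c + 1) n := by
  rcases n with _ | n
  · simp [bimomentDet]
  refine (det_eq_of_forall_col_eq_smul_add_pred (fun _ => -t) (fun i => ?_) fun i j => ?_).symm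
  · simp only [of_apply, Fin.val_zero, zero_add, ← bimoment_add_col hφ]
    rw [bimoment_of_lt t φ K (q + 1) (show 2 * c < i + r by omega)]
    ring
  · simp only [of_apply, Fin.val_succ, Fin.val_castSucc]
    rw [show (j : ℕ) + 1 + (c + 1) = j + (c + 1) + 1 by omega, ← bimoment_add_col hφ]
    ring

/-- The octahedron relation for the determinants of bimoments. -/
theorem bimomentDet_octahedron (t : R) (K q n : ℕ) :
    bimomentDet t 1 K (q + 1) 1 1 (n + 2) * bimomentDet t 1 (K + 2) (q + 1) 1 1 n =
      bimomentDet t 1 (K + 2) (q + 2) 1 1 n * bimomentDet t 1 K q 1 1 (n + 2) +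
        t * (bimomentDet t 1 K (q + 1) 1 1 (n + 1) *
          bimomentDet t 1 (K + 2) (q + 1) 1 1 (n + 1)) := by
  set ψ : PowerSeries R := 1 + PowerSeries.C t * (PowerSeries.X * (1 + PowerSeries.X)) with hψ
  have hψ1 : PowerSeries.constantCoeff ψ = ((1 : Rˣ) : R) := by simp [hψ]
  set φ : PowerSeries R := PowerSeries.invOfUnit ψ 1
  have hφ : φ * ψ = 1 := by rw [mul_comm]; exact PowerSeries.mul_invOfUnit ψ 1 hψ1
  have hφ1 : PowerSeries.constantCoeff φ = 1 := by simp [φ]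
  have key := det_add_succ_row_plucker
    (fun a b => bimoment t φ K (q + 1) (a + 1) (b + 1)) t (n + 1)
  simp only [show ∀ a, a + 2 + 1 = a + 1 + 1 + 1 from fun _ => rfl, bimoment_add_row hφ] at key
  have hE : ∀ m, bimomentDet t φ K (q + 1) 2 1 (m + 1) = bimomentDet t 1 (K + 2) (q + 1) 1 1 m := by
    intro m
    rw [bimomentDet_two_mul t hφ1 K (q + 1) 1 m, ← bimomentDet_one_eq hφ K q 1 m (by norm_num),
      bimomentDet_add_two]
  have hW : bimomentDet t 1 K (q + 1) 2 1 (n + 1) = bimomentDet t 1 (K + 2) (q + 2) 1 1 n := by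
    rw [bimomentDet_two_mul t (map_one _) K (q + 1) 1 n, bimomentDet_add_two]
  rw [← hE, ← hE, ← hW, bimomentDet_one_eq hφ K q 0 (n + 2) (by norm_num)]
  exact key

end Bimoment

theorem coeff_one_add_C_mul_X_pow {R : Type*} [CommRing R] (t : R) (N m : ℕ) :
    PowerSeries.coeff m ((1 + PowerSeries.C t * PowerSeries.X : PowerSeries R) ^ N) =
      N.choose m * t ^ m := by
  have h : (1 + PowerSeries.C t * PowerSeries.X : PowerSeries R) ^ N =
      (((1 + Polynomial.X) ^ N : R[X]).comp (Polynomial.C t * Polynomial.X) : R[X]) := by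
    simp
  rw [h, Polynomial.coeff_coe, Polynomial.comp_C_mul_X_coeff, Polynomial.coeff_one_add_X_pow]

theorem bimoment_one_eq_sum {R : Type*} [CommRing R] (t : R) (K q a b p : ℕ) (hb : b ≤ p) :
    bimoment t 1 K q a b = ∑ r ∈ range (2 * p + 1),
      if a ≤ r ∧ r ≤ 2 * b then
        ((a + K).choose (r - a) : R) * ((b + q).choose (2 * b - r) * t ^ (2 * b - r)) else 0 := by
  have h1 : (1 + PowerSeries.X : PowerSeries R) = 1 + PowerSeries.C 1 * PowerSeries.X := by simp
  rw [bimoment, mul_one, ← mul_assoc, PowerSeries.coeff_mul,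
    Finset.Nat.sum_antidiagonal_eq_sum_range_succ_mk]
  rw [← Finset.sum_subset (Finset.range_mono (show 2 * b + 1 ≤ 2 * p + 1 by omega))]
  · refine Finset.sum_congr rfl fun r hr => ?_
    have hr' : r ≤ 2 * b := by simpa [Nat.lt_succ_iff] using hr
    rw [PowerSeries.coeff_X_pow_mul', coeff_one_add_C_mul_X_pow, h1, coeff_one_add_C_mul_X_pow]
    by_cases ha : a ≤ r <;> simp [ha, hr']
  · intro r _ hr
    rw [if_neg]
    simp at hr
    omega

theorem Tpoly_eq_bimomentDet {L p k : ℤ} {P K q : ℕ} (hp : p = P) (hk : k = K + 1)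
    (hL : L = 2 * p + k + q) :
    Tpoly L p k = bimomentDet (X ^ 2 : ℤ[X]) 1 K q 1 1 P := by
  obtain rfl : p.toNat = P := by omega
  rw [Tpoly, bimomentDet]
  congr 1
  ext1 ℓ m
  simp only [Matrix.of_apply]
  rw [bimoment_one_eq_sum (X ^ 2 : ℤ[X]) K q (ℓ + 1) (m + 1) p.toNat (by omega)]
  refine Finset.sum_congr rfl fun r _ => ?_
  have h1 : ((ℓ : ℤ) + 1 + k - 1).toNat = ℓ + 1 + K := by omega
  have h2 : ((m : ℤ) + 1 + L - 2 * p - k).toNat = m + 1 + q := by omega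
  have h3 : ((r : ℤ) - ((ℓ : ℤ) + 1)).toNat = r - (ℓ + 1) := by omega
  have h4 : (2 * ((m : ℤ) + 1) - (r : ℤ)).toNat = 2 * (m + 1) - r := by omega
  have h5 : (2 * (2 * ((m : ℤ) + 1) - (r : ℤ))).toNat = 2 * (2 * (m + 1) - r) := by omega
  simp only [intChoose, h1, h2, h3, h4, h5]
  split_ifs with ha hb hc hc hc hc
  all_goals first | omega | simp [pow_mul, mul_assoc]

/-- `f(n,i,j) := T(n+j, n+i, j-n-i)` solves the discrete Hirota (octahedron) equation. -/
theorem Tpoly_discrete_Hirota (n i j : ℤ) (hni : 2 ≤ n + i) (hi : i ≤ -1)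
    (hj : 1 ≤ j - n - i) :
    (fun n i j => Tpoly (n + j) (n + i) (j - n - i) : ℤ → ℤ → ℤ → Polynomial ℤ) n i j *
        (fun n i j => Tpoly (n + j) (n + i) (j - n - i)) (n - 2) i j =
      (fun n i j => Tpoly (n + j) (n + i) (j - n - i)) (n - 1) (i - 1) j *
          (fun n i j => Tpoly (n + j) (n + i) (j - n - i)) (n - 1) (i + 1) j +
        Polynomial.X ^ 2 *
          ((fun n i j => Tpoly (n + j) (n + i) (j - n - i)) (n - 1) i (j - 1) *
            (fun n i j => Tpoly (n + j) (n + i) (j - n - i)) (n - 1) i (j + 1)) := by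
  obtain ⟨N, hN⟩ := Int.eq_ofNat_of_zero_le (sub_nonneg.mpr hni)
  obtain ⟨Q, hQ⟩ := Int.eq_ofNat_of_zero_le (show 0 ≤ -i - 1 by omega)
  obtain ⟨K, hK⟩ := Int.eq_ofNat_of_zero_le (sub_nonneg.mpr hj)
  have key := bimomentDet_octahedron (X ^ 2 : ℤ[X]) K Q N
  beta_reduce
  rw [Tpoly_eq_bimomentDet (P := N + 2) (K := K) (q := Q + 1),
    Tpoly_eq_bimomentDet (P := N) (K := K + 2) (q := Q + 1),
    Tpoly_eq_bimomentDet (P := N) (K := K + 2) (q := Q + 2),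
    Tpoly_eq_bimomentDet (P := N + 2) (K := K) (q := Q),
    Tpoly_eq_bimomentDet (P := N + 1) (K := K) (q := Q + 1),
    Tpoly_eq_bimomentDet (P := N + 1) (K := K + 2) (q := Q + 1), key]
  all_goals push_cast; omega
end

section
/- Let τ be an indeterminate and n ≥ 1. Then Σ_A τ^{2·ν(A)} = T(2n, n−1, 2) in ℤ[τ], where the sum is over all vertically symmetric alternating sign matrices A of order 2n+1, and ν(A) is the number of entries equal to −1 of A lying in columns 1 through n (i.e. strictly to the left of the middle column). In particular, the left-hand side is the τ²-enumeration A_V(2n+1; τ²) of vertically symmetric alternating sign matrices. -/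
open Polynomial Finset

/-- `A` is an alternating sign matrix: entries in `{-1,0,1}`, all row and column sums equal `1`,
    and all partial sums along each row (from the left) and each column (from the top) lie in
    `{0,1}`. -/
def IsASM {N : ℕ} (A : Matrix (Fin N) (Fin N) ℤ) : Prop :=
  (∀ i j, A i j = -1 ∨ A i j = 0 ∨ A i j = 1) ∧
    (∀ i, ∑ j, A i j = 1) ∧
    (∀ j, ∑ i, A i j = 1) ∧
    (∀ i j, (∑ j' ∈ Finset.Iic j, A i j') = 0 ∨ (∑ j' ∈ Finset.Iic j, A i j') = 1) ∧
    (∀ i j, (∑ i' ∈ Finset.Iic i, A i' j) = 0 ∨ (∑ i' ∈ Finset.Iic i, A i' j) = 1)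

/-- `A` is vertically symmetric: `a_{i,j} = a_{i,N+1-j}` for all `i, j`. -/
def IsVSym {N : ℕ} (A : Matrix (Fin N) (Fin N) ℤ) : Prop :=
  ∀ i j, A i j = A i j.rev

/-- `ν(A)`: the number of entries of `A` equal to `-1` lying strictly to the left of the middle
    column (i.e. in the first `n` columns of a matrix of order `2n+1`). -/
def numNegLeft (n : ℕ) (A : Matrix (Fin (2 * n + 1)) (Fin (2 * n + 1)) ℤ) : ℕ :=
  (Finset.univ.filter
    (fun ij : Fin (2 * n + 1) × Fin (2 * n + 1) => A ij.1 ij.2 = -1 ∧ (ij.2 : ℕ) < n)).card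

section LatticePathDeterminant

variable {K : Type*} [CommRing K]

/-- Complete homogeneous polynomials of two quantities with sum `s` and product `p`. -/
def lucasSeq {R : Type*} [CommRing R] (s p : R) : ℕ → R
  | 0 => 1
  | 1 => s
  | n + 2 => s * lucasSeq s p (n + 1) - p * lucasSeq s p n

theorem map_lucasSeq {R S : Type*} [CommRing R] [CommRing S] (f : R →+* S) (s p : R) :
    ∀ n, f (lucasSeq s p n) = lucasSeq (f s) (f p) n
  | 0 => by simp [lucasSeq]
  | 1 => by simp [lucasSeq]
  | n + 2 => by simp [lucasSeq, map_lucasSeq f s p (n + 1), map_lucasSeq f s p n]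

theorem lucasSeq_smul {R : Type*} [CommRing R] (c s p : R) :
    ∀ n, lucasSeq (c * s) (c ^ 2 * p) n = c ^ n * lucasSeq s p n
  | 0 => by simp [lucasSeq]
  | 1 => by simp [lucasSeq]
  | n + 2 => by
    simp only [lucasSeq, lucasSeq_smul c s p (n + 1), lucasSeq_smul c s p n]
    ring

theorem pow_sub_pow_eq_lucasSeq {R : Type*} [CommRing R] (a b : R) :
    ∀ n, a ^ (n + 1) - b ^ (n + 1) = (a - b) * lucasSeq (a + b) (a * b) n
  | 0 => by simp [lucasSeq]
  | 1 => by simp only [lucasSeq]; ring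
  | n + 2 => by
    simp only [lucasSeq, mul_sub, mul_left_comm (a - b), ← pow_sub_pow_eq_lucasSeq a b (n + 1),
      ← pow_sub_pow_eq_lucasSeq a b n]
    ring

/-- The polynomial in `ε` expressing `h_n(z (z + Q), w (w + Q))`, where `z + w = ε = - z w`. -/
noncomputable def rPoly (Q : K) : ℕ → K[X] :=
  lucasSeq (X ^ 2 + C (2 + Q) * X) (-(X * (C (Q - 1) * X + C (Q ^ 2))))

/-- The rescaling of `rPoly` by `ε = Q² t`. -/
noncomputable def rhoPoly (Q : K) : ℕ → K[X] :=
  lucasSeq (C (Q ^ 2) * X ^ 2 + C (2 + Q) * X) (-(X * (C (Q - 1) * X + 1)))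

theorem rPoly_comp (Q : K) (n : ℕ) :
    (rPoly Q n).comp (C (Q ^ 2) * X) = C (Q ^ 2) ^ n * rhoPoly Q n := by
  rw [rhoPoly, ← lucasSeq_smul, rPoly]
  have := map_lucasSeq (Polynomial.compRingHom (C (Q ^ 2) * X : K[X]))
    (X ^ 2 + C (2 + Q) * X) (-(X * (C (Q - 1) * X + C (Q ^ 2)))) n
  rw [Polynomial.coe_compRingHom_apply] at this
  rw [this]
  congr 1 <;> simp <;> ring

theorem coeff_rPoly_mul (Q : K) (n i : ℕ) :
    (Q ^ 2) ^ i * (rPoly Q n).coeff i = (Q ^ 2) ^ n * (rhoPoly Q n).coeff i := by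
  have h := congrArg (fun p => p.coeff i) (rPoly_comp Q n)
  simp only [comp_C_mul_X_coeff, ← C_pow, coeff_C_mul] at h
  rw [mul_comm, h]

/-- The generating function of the coefficients `[w^(2m)] h(w) (1 + Q w)^m`. -/
noncomputable def tauSeries (Q : K) (h : K[X]) : PowerSeries K :=
  PowerSeries.mk fun m => (h * (1 + C Q * X) ^ m).coeff (2 * m)

theorem tauSeries_add (Q : K) (g h : K[X]) :
    tauSeries Q (g + h) = tauSeries Q g + tauSeries Q h := by
  ext m; simp [tauSeries, add_mul]

theorem tauSeries_X_sq_mul (Q : K) (h : K[X]) :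
    tauSeries Q (X ^ 2 * h) =
      PowerSeries.X * (tauSeries Q h + PowerSeries.C Q * tauSeries Q (X * h)) := by
  ext m
  cases m with
  | zero => simp [tauSeries, mul_coeff_zero]
  | succ m =>
    simp only [tauSeries, PowerSeries.coeff_mk, PowerSeries.coeff_succ_X_mul, map_add,
      PowerSeries.coeff_C_mul]
    rw [← coeff_C_mul, ← coeff_add]
    rw [show X ^ 2 * h * (1 + C Q * X) ^ (m + 1) =
      (h * (1 + C Q * X) ^ m + C Q * (X * h * (1 + C Q * X) ^ m)) * X ^ 2 by ring,
      show 2 * (m + 1) = 2 * m + 2 by ring, coeff_mul_X_pow]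

theorem coeff_one_add_pow (Q : K) (m s : ℕ) :
    ((1 + C Q * X : K[X]) ^ m).coeff s = m.choose s * Q ^ s := by
  have h : (1 + C Q * X : K[X]) ^ m = ((1 + X) ^ m : K[X]).comp (C Q * X) := by simp
  rw [h, comp_C_mul_X_coeff, coeff_one_add_X_pow]

theorem tauSeries_one (Q : K) : tauSeries Q 1 = 1 := by
  ext m
  rw [tauSeries, PowerSeries.coeff_mk, one_mul, coeff_one_add_pow, PowerSeries.coeff_one]
  rcases m with _ | m
  · simp
  · rw [Nat.choose_eq_zero_of_lt (by omega)]; simp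

theorem tauSeries_X (Q : K) : tauSeries Q X = PowerSeries.C Q * PowerSeries.X := by
  ext m
  rw [tauSeries, PowerSeries.coeff_mk, PowerSeries.coeff_C_mul, PowerSeries.coeff_X]
  rcases m with _ | _ | m
  · simp
  · rw [show 2 * (0 + 1) = 1 + 1 by rfl, coeff_X_mul, coeff_one_add_pow]; simp
  · rw [show 2 * (m + 2) = (2 * m + 3) + 1 by ring, coeff_X_mul, coeff_one_add_pow,
      Nat.choose_eq_zero_of_lt (by omega)]; simp

theorem tauSeries_eq (Q : K) : ∀ n, tauSeries Q ((1 + X) * (X + X ^ 2) ^ n) =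
    (((1 + C Q * X) * rhoPoly Q n : K[X]) : PowerSeries K)
  | 0 => by
    simp [rhoPoly, lucasSeq, tauSeries_add, tauSeries_one, tauSeries_X]
  | 1 => by
    have h3 := tauSeries_X_sq_mul Q X
    have h2 := tauSeries_X_sq_mul Q 1
    rw [show (1 + X) * (X + X ^ 2) ^ 1 = X + X ^ 2 * 1 + X ^ 2 * 1 + X ^ 2 * (X : K[X]) by ring]
    simp only [tauSeries_add, h3, ← pow_two, mul_one, tauSeries_one, tauSeries_X] at h2 ⊢
    rw [h2]
    simp [rhoPoly, lucasSeq, show PowerSeries.C (2 : K) = 2 from map_ofNat _ 2]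
    ring
  | n + 2 => by
    set h : K[X] := (1 + X) * (X + X ^ 2) ^ n with hh
    have e1 : (1 + X) * (X + X ^ 2) ^ (n + 1) = X * h + X ^ 2 * h := by rw [hh]; ring
    have e2 : (1 + X) * (X + X ^ 2) ^ (n + 2) =
      X ^ 2 * h + X ^ 2 * (X * h) + X ^ 2 * (X * h) + X ^ 2 * (X ^ 2 * h) := by rw [hh]; ring
    have i0 := tauSeries_eq Q n
    have i1 := tauSeries_eq Q (n + 1)
    have a2 := tauSeries_X_sq_mul Q h
    have a3 := tauSeries_X_sq_mul Q (X * h)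
    have a4 := tauSeries_X_sq_mul Q (X ^ 2 * h)
    rw [show X * (X * h) = X ^ 2 * h by ring] at a3
    rw [show X * (X ^ 2 * h) = X ^ 2 * (X * h) by ring] at a4
    rw [← hh] at i0
    rw [e1, tauSeries_add] at i1
    rw [e2, tauSeries_add, tauSeries_add, tauSeries_add]
    have e3 : (1 + C Q * X) * rhoPoly Q (n + 2) =
        (C (Q ^ 2) * X ^ 2 + C (2 + Q) * X) * ((1 + C Q * X) * rhoPoly Q (n + 1)) -
        (-(X * (C (Q - 1) * X + 1))) * ((1 + C Q * X) * rhoPoly Q n) := by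
      rw [show rhoPoly Q (n + 2) = _ * rhoPoly Q (n + 1) - _ * rhoPoly Q n from rfl]
      ring
    rw [e3, Polynomial.coe_sub, Polynomial.coe_mul, Polynomial.coe_mul _ (_ * rhoPoly Q n),
      ← i1, ← i0, a4, a3, a2]
    simp [show PowerSeries.C (2 : K) = 2 from map_ofNat _ 2]
    ring

theorem coeff_tau_eq (Q : K) (l m : ℕ) :
    ((1 + X) * (X + X ^ 2) ^ l * (1 + C Q * X : K[X]) ^ m).coeff (2 * m) =
      ((1 + C Q * X) * rhoPoly Q l).coeff m := by
  have := congrArg (PowerSeries.coeff m) (tauSeries_eq Q l)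
  rwa [tauSeries, PowerSeries.coeff_mk, Polynomial.coeff_coe] at this

theorem det_coeff_one_add_mul (Q : K) (f : ℕ → K[X]) (n : ℕ) :
    (Matrix.of fun l m : Fin n => ((1 + C Q * X) * f l).coeff m).det =
      (Matrix.of fun l m : Fin n => (f l).coeff m).det := by
  have h : (Matrix.of fun l m : Fin n => ((1 + C Q * X) * f l).coeff m) =
      (Matrix.of fun l m : Fin n => (f l).coeff m) *
      (Matrix.of fun i j : Fin n => if (i : ℕ) = j then 1 else if (i : ℕ) + 1 = j then Q else 0) := by
    ext l m
    rw [Matrix.mul_apply]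
    simp only [Matrix.of_apply]
    rw [show (1 + C Q * X) * f l = f l + X * (C Q * f l) by ring, coeff_add]
    rcases hm : (m : ℕ) with _ | k
    · rw [Finset.sum_eq_single m]
      · simp [hm]
      · intro b _ hb
        have : (b : ℕ) ≠ 0 := fun h => hb (Fin.ext (by omega))
        simp [this]
      · simp
    · have hk : k < n := by omega
      have hne : (⟨k, hk⟩ : Fin n) ≠ m := fun h => by
        have := congrArg Fin.val h; simp at this; omega
      rw [coeff_X_mul, coeff_C_mul, Finset.sum_eq_add m ⟨k, hk⟩ hne.symm]
      · simp [hm, mul_comm]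
      · rintro c - ⟨h1, h2⟩
        have a1 : (c : ℕ) ≠ k + 1 := fun h => h1 (Fin.ext (by omega))
        have a2 : (c : ℕ) ≠ k := fun h => h2 (Fin.ext (by simp [h]))
        simp [a1, a2]
      · simp
      · simp
  rw [h, Matrix.det_mul]
  have ht : (Matrix.of fun i j : Fin n =>
      if (i : ℕ) = j then (1 : K) else if (i : ℕ) + 1 = j then Q else 0).det = 1 := by
    rw [Matrix.det_of_isUpperTriangular]
    · simp
    · intro i j hij
      have hij : (j : ℕ) < i := hij
      simp only [Matrix.of_apply]
      rw [if_neg (by omega), if_neg (by omega)]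
  rw [ht, mul_one]

theorem det_rPoly_eq_det_rhoPoly [IsDomain K] {Q : K} (hQ : Q ≠ 0) (n : ℕ) :
    (Matrix.of fun l m : Fin n => (rPoly Q l).coeff m).det =
      (Matrix.of fun l m : Fin n => (rhoPoly Q l).coeff m).det := by
  have h1 := Matrix.det_mul_row (fun i : Fin n => (Q ^ 2) ^ (i : ℕ))
    (Matrix.of fun l m : Fin n => (rPoly Q l).coeff m)
  have h2 := Matrix.det_mul_column (fun i : Fin n => (Q ^ 2) ^ (i : ℕ))
    (Matrix.of fun l m : Fin n => (rhoPoly Q l).coeff m)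
  simp only [Matrix.of_apply, coeff_rPoly_mul] at h1 h2
  have h0 : ∏ i : Fin n, (Q ^ 2) ^ (i : ℕ) ≠ 0 :=
    Finset.prod_ne_zero_iff.2 fun i _ => pow_ne_zero _ (pow_ne_zero _ hQ)
  exact mul_left_cancel₀ h0 (h1.symm.trans h2)

theorem intChoose_natCast (a b : ℕ) : intChoose a b = a.choose b := by simp [intChoose]

theorem Tpoly_entry (l m N : ℕ) (hm : m < N) :
    (∑ r ∈ Finset.range (2 * N + 1),
      Polynomial.C (intChoose ((l : ℤ) + 1 + 2 - 1) ((r : ℤ) - ((l : ℤ) + 1)) *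
          intChoose (((m : ℤ) + 1) + 2 * (N + 1) - 2 * N - 2) (2 * ((m : ℤ) + 1) - (r : ℤ))) *
        (Polynomial.X : ℤ[X]) ^ (2 * (2 * ((m : ℤ) + 1) - (r : ℤ))).toNat) =
    ((1 + X) * (X + X ^ 2) ^ (l + 1) *
      (1 + C (X ^ 2 : ℤ[X]) * X : ℤ[X][X]) ^ (m + 1)).coeff (2 * (m + 1)) := by
  rw [show ((1 + X) * (X + X ^ 2) ^ (l + 1) : ℤ[X][X]) = X ^ (l + 1) * (1 + X) ^ (l + 2) by
    rw [show (X + X ^ 2 : ℤ[X][X]) = X * (1 + X) by ring, mul_pow]; ring]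
  rw [coeff_mul, Finset.Nat.sum_antidiagonal_eq_sum_range_succ_mk]
  rw [← Finset.sum_subset (Finset.range_subset_range.2
    (show (2 * (m + 1)).succ ≤ 2 * N + 1 by omega))]
  · refine Finset.sum_congr rfl fun r hr => ?_
    have hr' : r ≤ 2 * (m + 1) := by simpa [Nat.lt_succ_iff] using hr
    obtain ⟨s, hs⟩ := Nat.exists_eq_add_of_le hr'
    rw [show (2 * (m + 1) - r) = s by omega]
    rw [show 2 * ((m : ℤ) + 1) - (r : ℤ) = (s : ℕ) by omega,
      show ((m : ℤ) + 1) + 2 * (N + 1) - 2 * N - 2 = ((m + 1 : ℕ) : ℤ) by push_cast; ring,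
      show (l : ℤ) + 1 + 2 - 1 = ((l + 2 : ℕ) : ℤ) by push_cast; ring, intChoose_natCast,
      coeff_one_add_pow, show (2 * (s : ℤ)).toNat = 2 * s by omega, coeff_X_pow_mul']
    split_ifs with h
    · rw [show (r : ℤ) - ((l : ℤ) + 1) = ((r - (l + 1) : ℕ) : ℤ) by omega, intChoose_natCast,
        coeff_one_add_X_pow]
      simp only [map_mul, map_natCast, pow_mul]
      ring
    · rw [intChoose, if_neg (by omega)]; simp
  · intro r _ hr
    have hr' : ¬ r < (2 * (m + 1)).succ := by simpa using hr
    rw [intChoose, intChoose, if_neg (show ¬ (0 ≤ 2 * ((m : ℤ) + 1) - (r : ℤ)) by omega)]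
    simp

theorem det_rPoly_eq_Tpoly (N : ℕ) :
    (Matrix.of fun l m : Fin (N + 1) => (rPoly (X ^ 2 : ℤ[X]) l).coeff m).det =
      Tpoly (2 * ((N : ℤ) + 1)) N 2 := by
  rw [det_rPoly_eq_det_rhoPoly (pow_ne_zero 2 X_ne_zero), ← det_coeff_one_add_mul (X ^ 2 : ℤ[X])]
  simp only [← coeff_tau_eq]
  rw [Matrix.det_succ_column_zero, Fin.sum_univ_succ]
  have hz : ∀ i : Fin N, ((1 + X) * (X + X ^ 2) ^ ((i.succ : Fin (N + 1)) : ℕ) *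
      (1 + C (X ^ 2 : ℤ[X]) * X : ℤ[X][X]) ^ ((0 : Fin (N + 1)) : ℕ)).coeff
        (2 * ((0 : Fin (N + 1)) : ℕ)) = 0 := by
    intro i
    simp [coeff_zero_eq_eval_zero]
  simp only [Matrix.of_apply, hz]
  simp only [Fin.val_zero, pow_zero, mul_zero, zero_mul, Finset.sum_const_zero, add_zero, mul_one,
    one_mul]
  have h1 : ((1 : ℤ[X][X]) + X).coeff 0 = 1 := by simp
  rw [h1, one_mul, Tpoly]
  congr 1
  ext1 l m
  simp only [Matrix.submatrix_apply, Fin.zero_succAbove, Matrix.of_apply, Fin.val_succ]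
  exact (Tpoly_entry l m N m.2).symm

end LatticePathDeterminant

section AntisymmetrizerLimit

/-- The weight `1 + (Q - 2) u + u v` of a pair of variables. -/
def pairWeight {R : Type*} [CommRing R] (Q u v : R) : R := 1 + (Q - 2) * u + u * v

section Limit

variable {K A : Type*} [CommRing K] [CommRing A] [Algebra K A]

theorem exists_det_eval_eq_vandermonde_mul [Nontrivial A] (φ : A →ₐ[K] K) {n : ℕ} (p : Fin n → K[X])
    (x : Fin n → A) (hx : ∀ i, φ (x i) = 0) :
    ∃ S : A, (Matrix.of fun i j => aeval (x i) (p j)).det = (Matrix.vandermonde x).det * S ∧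
      φ S = (Matrix.of fun i j : Fin n => (p j).coeff i).det := by
  set P : A[X] := ∏ i, (X - C (x i)) with hP
  have hPm : P.Monic := monic_prod_of_monic _ _ fun i _ => monic_X_sub_C _
  have hPd : P.natDegree = n := by simp [hP, natDegree_prod_of_monic, monic_X_sub_C]
  have hPφ : P.map (φ : A →+* K) = X ^ n := by
    rw [hP, Polynomial.map_prod]
    simp [hx]
  set R : Fin n → A[X] := fun j => (p j).map (algebraMap K A) %ₘ P with hR
  refine ⟨(Matrix.of fun i j : Fin n => (R j).coeff i).det, ?_, ?_⟩
  · rw [← Matrix.det_mul]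
    congr 1
    ext i j
    rw [Matrix.mul_apply]
    simp only [Matrix.of_apply, Matrix.vandermonde_apply]
    have h0 : P.eval (x i) = 0 := by
      rw [hP, eval_prod]; exact Finset.prod_eq_zero (Finset.mem_univ i) (by simp)
    have h1 : aeval (x i) (p j) = (R j).eval (x i) := by
      rw [aeval_def, ← eval_map, hR]
      conv_lhs => rw [← modByMonic_add_div ((p j).map (algebraMap K A)) P]
      simp [h0]
    have h2 : (R j).natDegree < n := by
      refine lt_of_lt_of_eq (natDegree_modByMonic_lt _ hPm fun h => ?_) hPd
      rw [h, natDegree_one] at hPd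
      exact absurd i.2 (by omega)
    rw [h1, eval_eq_sum_range' h2, Finset.sum_range]
    exact Finset.sum_congr rfl fun k _ => mul_comm _ _
  · rw [AlgHom.map_det]
    congr 1
    ext i j
    simp only [AlgHom.mapMatrix_apply, Matrix.map_apply, Matrix.of_apply]
    have h3 : (R j).map (φ : A →+* K) = p j %ₘ X ^ n := by
      rw [hR, Polynomial.map_modByMonic _ hPm, hPφ, Polynomial.map_map]
      congr 1
      rw [show (φ : A →+* K).comp (algebraMap K A) = RingHom.id K from φ.comp_algebraMap]
      simp
    have h4 := congrArg (fun q => q.coeff (i : ℕ)) h3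
    simp only [coeff_map] at h4
    refine h4.trans ?_
    have h5 := congrArg (fun q => q.coeff (i : ℕ)) (modByMonic_add_div (p j) (X ^ n))
    simp only [coeff_add, coeff_X_pow_mul'] at h5
    rwa [if_neg (by omega), add_zero] at h5

/-- Antisymmetrization of a function of a sequence of arguments in its first `n` arguments, the
others being set to `1`. -/
def asym : (n : ℕ) → ((ℕ → A) → A) → (Fin n → A) → A
  | 0, f, _ => f 1
  | n + 1, f, u => ∑ k : Fin (n + 1), (-1) ^ ((k : ℕ) + n) *
      asym n (fun v => f (Function.update v n (u k))) (u ∘ k.succAbove)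

theorem asym_congr : ∀ (n : ℕ) {f g : (ℕ → A) → A} (u : Fin n → A),
    (∀ v, (∀ i, n ≤ i → v i = 1) → f v = g v) → asym n f u = asym n g u
  | 0, f, g, u, h => h _ fun _ _ => rfl
  | n + 1, f, g, u, h => by
    refine Finset.sum_congr rfl fun k _ => ?_
    rw [asym_congr n _ fun v hv => h _ fun i hi => ?_]
    rw [Function.update_of_ne (by omega), hv i (by omega)]

theorem asym_add : ∀ (n : ℕ) (f g : (ℕ → A) → A) (u : Fin n → A),
    asym n (fun v => f v + g v) u = asym n f u + asym n g u
  | 0, f, g, u => rfl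
  | n + 1, f, g, u => by simp only [asym, asym_add n, mul_add, Finset.sum_add_distrib]

theorem asym_mul_prod : ∀ (n : ℕ) (f : (ℕ → A) → A) (u : Fin n → A) (c : A) (h : A → A),
    asym n (fun v => f v * (c * ∏ i ∈ range n, h (v i))) u = asym n f u * (c * ∏ i, h (u i))
  | 0, f, u, c, h => by simp [asym]
  | n + 1, f, u, c, h => by
    simp only [asym, Finset.sum_mul]
    refine Finset.sum_congr rfl fun k _ => ?_
    have ih := asym_mul_prod n (fun v => f (Function.update v n (u k))) (u ∘ k.succAbove)
      (c * h (u k)) h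
    simp only [Function.comp_apply] at ih
    rw [mul_assoc, Fin.prod_univ_succAbove _ k, ← mul_assoc c, ← ih]
    congr 2
    ext v
    rw [Finset.prod_range_succ, Function.update_self, mul_comm _ (h (u k)), ← mul_assoc c]
    congr 2
    refine Finset.prod_congr rfl fun i hi => ?_
    rw [Function.update_of_ne (by have := Finset.mem_range.1 hi; omega)]

theorem asym_prod : ∀ (n : ℕ) (g : ℕ → A → A) (u : Fin n → A) (c : A),
    asym n (fun v => c * ∏ i ∈ range n, g i (v i)) u =
      c * (Matrix.of fun i j : Fin n => g j (u i)).det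
  | 0, g, u, c => by simp [asym]
  | n + 1, g, u, c => by
    rw [Matrix.det_succ_column _ (Fin.last n), Finset.mul_sum]
    simp only [asym]
    refine Finset.sum_congr rfl fun k _ => ?_
    have h : asym n (fun v => c * ∏ i ∈ range (n + 1), g i (Function.update v n (u k) i))
        (u ∘ k.succAbove) = asym n (fun v => c * g n (u k) * ∏ i ∈ range n, g i (v i))
        (u ∘ k.succAbove) := by
      congr 1
      ext v
      rw [Finset.prod_range_succ, Function.update_self, mul_comm _ (g n (u k)), ← mul_assoc c]
      congr 1
      refine Finset.prod_congr rfl fun i hi => ?_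
      rw [Function.update_of_ne (by have := Finset.mem_range.1 hi; omega)]
    rw [h, asym_prod n]
    simp only [Fin.succAbove_last, Matrix.of_apply, Fin.val_last]
    have : (Matrix.of fun i j : Fin n => g j ((u ∘ k.succAbove) i)) =
      (Matrix.of fun i j : Fin (n + 1) => g j (u i)).submatrix k.succAbove Fin.castSucc := by
      ext; simp
    rw [this]
    ring

/-- The linear functional taking a monomial with exponents `k` to the determinant of
`C(k i, j + s i)`, for `i, j < n`. -/
noncomputable def binomDet (K : Type*) [CommRing K] (n : ℕ) (s : ℕ → ℕ) :
    MvPolynomial ℕ K →ₗ[K] K :=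
  (MvPolynomial.basisMonomials ℕ K).constr K fun k =>
    (Matrix.of fun i j : Fin n => ((k i).choose (j + s i) : K)).det

theorem binomDet_monomial (n : ℕ) (s : ℕ → ℕ) (k : ℕ →₀ ℕ) (c : K) :
    binomDet K n s (MvPolynomial.monomial k c) =
      c * (Matrix.of fun i j : Fin n => ((k i).choose (j + s i) : K)).det := by
  have h : MvPolynomial.monomial k c = c • MvPolynomial.basisMonomials ℕ K k := by
    simp [MvPolynomial.smul_monomial]
  rw [h, map_smul, binomDet, Module.Basis.constr_basis, smul_eq_mul]

theorem exists_asym_eq_vandermonde_mul [Nontrivial A] (φ : A →ₐ[K] K) {n : ℕ} (G : MvPolynomial ℕ K)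
    (x : Fin n → A) (hx : ∀ i, φ (x i) = 0) :
    ∃ S : A, asym n (fun v => MvPolynomial.aeval v G) (fun i => 1 + x i) =
      (Matrix.vandermonde x).det * S ∧ φ S = binomDet K n 0 G := by
  induction G using MvPolynomial.induction_on' with
  | monomial k c =>
    obtain ⟨S, hS, hφ⟩ := exists_det_eval_eq_vandermonde_mul φ
      (fun j : Fin n => ((1 + X) ^ k j : K[X])) x hx
    refine ⟨algebraMap K A c * S, ?_, ?_⟩
    · rw [asym_congr (g := fun v => algebraMap K A c * ∏ i ∈ range n, v i ^ k i),
        asym_prod n (fun i a => a ^ k i), mul_left_comm, ← hS]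
      · simp
      · intro v hv
        rw [MvPolynomial.aeval_monomial]
        congr 1
        rw [Finsupp.prod_of_support_subset (s := k.support ∪ range n) _
          Finset.subset_union_left _ (by simp)]
        symm
        refine Finset.prod_subset Finset.subset_union_right fun i _ hi => ?_
        rw [hv i (by simpa using hi), one_pow]
    · rw [map_mul, hφ, binomDet_monomial, AlgHom.commutes, Algebra.algebraMap_self, RingHom.id_apply,
        ← Matrix.det_transpose]
      congr 2
      ext i j
      simp [coeff_one_add_X_pow]
  | add p q hp hq =>
    obtain ⟨S, hS, hφ⟩ := hp
    obtain ⟨S', hS', hφ'⟩ := hq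
    refine ⟨S + S', ?_, by simp [hφ, hφ']⟩
    simp only [map_add, asym_add, hS, hS', mul_add]

end Limit

section Domain

variable {A : Type*} [CommRing A]

/-- The antisymmetrization of `∏ u_i^(2i+1) ∏_{i<j} pairWeight u_i u_j`. -/
def oddAsym (Q : A) : (n : ℕ) → (Fin n → A) → A
  | 0, _ => 1
  | n + 1, u => ∑ k : Fin (n + 1), (-1) ^ ((k : ℕ) + n) *
      (oddAsym Q n (u ∘ k.succAbove) *
        (u k ^ (2 * n + 1) * ∏ i, pairWeight Q (u (k.succAbove i)) (u k)))

theorem det_powers_expansion {n : ℕ} (Z Z' : Fin (n + 1) → A) (a b : Fin (n + 1) → A)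
    (h0 : ∀ k, ∏ i, (a i * Z' k + b i) = 0) :
    (∏ i, a i) * (Matrix.of fun i j : Fin (n + 1) => Z i ^ (j + 1 : ℕ) - Z' i ^ (j + 1 : ℕ)).det =
      ∑ k : Fin (n + 1), (-1) ^ ((k : ℕ) + n) * ((∏ i, (a i * Z k + b i)) *
        (Matrix.of fun i j : Fin n => Z (k.succAbove i) ^ (j + 1 : ℕ) -
          Z' (k.succAbove i) ^ (j + 1 : ℕ)).det) := by
  set M := Matrix.of fun i j : Fin (n + 1) => Z i ^ (j + 1 : ℕ) - Z' i ^ (j + 1 : ℕ) with hM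
  set p : A[X] := ∏ i, (C (a i) * X + C (b i)) with hp
  have hd : p.natDegree ≤ n + 1 := by
    refine (natDegree_prod_le _ _).trans ?_
    refine (Finset.sum_le_card_nsmul _ _ 1 fun i _ => natDegree_linear_le).trans (by simp)
  have hc : p.coeff (n + 1) = ∏ i, a i := by
    have := coeff_prod_of_natDegree_le (s := Finset.univ)
      (f := fun i : Fin (n + 1) => C (a i) * X + C (b i)) (n := 1) (fun i _ => natDegree_linear_le)
    simpa using this
  have he : ∀ z, p.eval z = ∏ i, (a i * z + b i) := fun z => by simp [hp, eval_prod]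
  have h1 := Matrix.det_updateCol_sum M (Fin.last n) (fun j => p.coeff (j + 1))
  simp only [Fin.val_last, hc, smul_eq_mul] at h1
  rw [← h1, Matrix.det_succ_column _ (Fin.last n)]
  refine Finset.sum_congr rfl fun k _ => ?_
  rw [mul_assoc, Matrix.updateCol_self, Fin.val_last]
  congr 2
  · have e1 := he (Z k)
    have e2 := he (Z' k)
    rw [h0, eval_eq_sum_range' (Nat.lt_succ_of_le hd), Finset.sum_range_succ'] at e2
    rw [eval_eq_sum_range' (Nat.lt_succ_of_le hd), Finset.sum_range_succ'] at e1
    rw [Finset.sum_range] at e1 e2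
    simp only [hM, Matrix.of_apply, mul_sub, Finset.sum_sub_distrib]
    linear_combination e1 - e2
  · congr 1
    ext i j
    simp [hM, Fin.succAbove_last]

theorem prod_pairs_succAbove {n : ℕ} (g : A → A → A) (hg : ∀ a b, g a b = g b a)
    (u : Fin (n + 1) → A) (k : Fin (n + 1)) :
    (∏ i, ∏ j, if i ≤ j then g (u i) (u j) else 1) =
      (∏ i : Fin n, ∏ j : Fin n,
        if i ≤ j then g (u (k.succAbove i)) (u (k.succAbove j)) else 1) *
      (g (u k) (u k) * ∏ i : Fin n, g (u (k.succAbove i)) (u k)) := by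
  rw [Fin.prod_univ_succAbove _ k]
  simp only [Fin.prod_univ_succAbove _ k, le_refl, if_true, Finset.prod_mul_distrib,
    Fin.succAbove_le_succAbove_iff]
  have : (∏ i : Fin n, if k ≤ k.succAbove i then g (u k) (u (k.succAbove i)) else 1) *
      (∏ i : Fin n, if k.succAbove i ≤ k then g (u (k.succAbove i)) (u k) else 1) =
      ∏ i : Fin n, g (u (k.succAbove i)) (u k) := by
    rw [← Finset.prod_mul_distrib]
    refine Finset.prod_congr rfl fun i _ => ?_
    have hne := Fin.succAbove_ne k i
    rcases lt_or_gt_of_ne hne with h | h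
    · rw [if_neg (not_le.2 h), if_pos h.le, one_mul]
    · rw [if_pos h.le, if_neg (not_le.2 h), mul_one, hg]
  rw [← this]
  ring

theorem oddAsym_mul_prod (Q : A) : ∀ (n : ℕ) (u w : Fin n → A), (∀ i, u i * w i = 1) →
    oddAsym Q n u * (∏ i, ∏ j, if i ≤ j then u i * u j - 1 else 1) *
      (∏ i, (u i + w i + (Q - 2))) =
    (∏ i, u i) ^ (2 * n) * (Matrix.of fun i j : Fin n =>
      ((u i + w i + (Q - 2)) * u i - Q) ^ (j + 1 : ℕ) -
      ((u i + w i + (Q - 2)) * w i - Q) ^ (j + 1 : ℕ)).det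
  | 0, u, w, h => by simp [oddAsym]
  | n + 1, u, w, h => by
    have key := det_powers_expansion (fun i => (u i + w i + (Q - 2)) * u i - Q)
      (fun i => (u i + w i + (Q - 2)) * w i - Q) (fun i => u i ^ 2)
      (fun i => u i ^ 2 * Q - u i * (u i + w i + (Q - 2))) (fun k => by
        refine Finset.prod_eq_zero (Finset.mem_univ k) ?_
        linear_combination (u k * (u k + w k + (Q - 2))) * h k)
    rw [show 2 * (n + 1) = 2 * n + 2 by ring, pow_add, mul_assoc (_ ^ _), ← Finset.prod_pow (n := 2), key,
      oddAsym, Finset.sum_mul, Finset.sum_mul, Finset.mul_sum]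
    refine Finset.sum_congr rfl fun k _ => ?_
    have ih := oddAsym_mul_prod Q n (u ∘ k.succAbove) (w ∘ k.succAbove) fun i => h _
    simp only [Function.comp_apply] at ih
    rw [prod_pairs_succAbove (fun a b => a * b - 1) (fun a b => by rw [mul_comm]) u k,
      Fin.prod_univ_succAbove (fun i => u i + w i + (Q - 2)) k, Fin.prod_univ_succAbove u k,
      mul_pow, Fin.prod_univ_succAbove _ k]
    have e1 : u k ^ 2 * ((u k + w k + (Q - 2)) * u k - Q) +
        (u k ^ 2 * Q - u k * (u k + w k + (Q - 2))) =
        u k * (u k + w k + (Q - 2)) * (u k * u k - 1) := by ring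
    have e2 : ∏ i : Fin n, (u (k.succAbove i) ^ 2 * ((u k + w k + (Q - 2)) * u k - Q) +
        (u (k.succAbove i) ^ 2 * Q - u (k.succAbove i) *
          (u (k.succAbove i) + w (k.succAbove i) + (Q - 2)))) =
        (∏ i : Fin n, pairWeight Q (u (k.succAbove i)) (u k)) *
        ∏ i : Fin n, (u (k.succAbove i) * u k - 1) := by
      rw [← Finset.prod_mul_distrib]
      refine Finset.prod_congr rfl fun i _ => ?_
      rw [pairWeight]
      linear_combination u (k.succAbove i) ^ 2 * h k - h (k.succAbove i)
    rw [e1, e2]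
    linear_combination ((-1) ^ ((k : ℕ) + n) * u k ^ (2 * n) * u k * (u k + w k + (Q - 2)) *
      (u k * u k - 1) * (∏ i : Fin n, pairWeight Q (u (k.succAbove i)) (u k)) *
      ∏ i : Fin n, (u (k.succAbove i) * u k - 1)) * ih

end Domain

end AntisymmetrizerLimit

section OddMinor

theorem prod_ite_le_eq {A : Type*} [CommMonoid A] {n : ℕ} (g : Fin n → Fin n → A) :
    (∏ i, ∏ j, if i ≤ j then g i j else 1) = (∏ i, g i i) * ∏ i, ∏ j ∈ Ioi i, g i j := by
  rw [← Finset.prod_mul_distrib]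
  refine Finset.prod_congr rfl fun i _ => ?_
  rw [← Finset.prod_filter, ← Finset.prod_cons (s := Ioi i) (a := i) (by simp),
    ← Finset.Ici_eq_cons_Ioi]
  congr 1
  ext; simp

theorem oddAsym_mul_prod_eq_det {A : Type*} [CommRing A] [IsDomain A] (Q : A) {n : ℕ}
    (u w : Fin n → A) (h : ∀ i, u i * w i = 1) (hu : ∀ i, u i * u i - 1 ≠ 0)
    (hy : ∀ i, u i + w i + (Q - 2) ≠ 0) :
    oddAsym Q n u * (∏ i, ∏ j ∈ Ioi i, (u i * u j - 1)) =
      (∏ i, u i) ^ (2 * n) * (∏ i, w i) * (Matrix.of fun i j : Fin n =>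
        lucasSeq ((u i + w i - 2) ^ 2 + (2 + Q) * (u i + w i - 2))
          (-((u i + w i - 2) * ((Q - 1) * (u i + w i - 2) + Q ^ 2))) j).det := by
  have key := oddAsym_mul_prod Q n u w h
  have e : ∀ i j : Fin n, ((u i + w i + (Q - 2)) * u i - Q) ^ (j + 1 : ℕ) -
      ((u i + w i + (Q - 2)) * w i - Q) ^ (j + 1 : ℕ) =
      ((u i + w i + (Q - 2)) * (u i * u i - 1) * w i) *
      lucasSeq ((u i + w i - 2) ^ 2 + (2 + Q) * (u i + w i - 2))
          (-((u i + w i - 2) * ((Q - 1) * (u i + w i - 2) + Q ^ 2))) j := by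
    intro i j
    rw [pow_sub_pow_eq_lucasSeq]
    congr 1
    · linear_combination -(u i + w i + (Q - 2)) * u i * h i
    · congr 1
      · ring
      · linear_combination (u i + w i + (Q - 2)) ^ 2 * h i
  simp only [e] at key
  have dm := Matrix.det_mul_column (fun i => (u i + w i + (Q - 2)) * (u i * u i - 1) * w i)
    (Matrix.of fun i j : Fin n => lucasSeq ((u i + w i - 2) ^ 2 + (2 + Q) * (u i + w i - 2))
          (-((u i + w i - 2) * ((Q - 1) * (u i + w i - 2) + Q ^ 2))) j)
  simp only [Matrix.of_apply] at dm
  rw [dm, prod_ite_le_eq (fun i j => u i * u j - 1)] at key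
  simp only [Finset.prod_mul_distrib] at key
  have h1 : ∏ i, (u i * u i - 1) ≠ 0 := Finset.prod_ne_zero_iff.2 fun i _ => hu i
  have h2 : ∏ i, (u i + w i + (Q - 2)) ≠ 0 := Finset.prod_ne_zero_iff.2 fun i _ => hy i
  refine mul_right_cancel₀ h1 (mul_right_cancel₀ h2 ?_)
  linear_combination key

theorem det_vandermonde_reciprocal {A : Type*} [CommRing A] {n : ℕ} (x w : Fin n → A)
    (h : ∀ i, (1 + x i) * w i = 1) :
    (Matrix.vandermonde fun i => 1 + x i + w i - 2).det =
      (Matrix.vandermonde x).det * (∏ i, ∏ j ∈ Ioi i, ((1 + x i) * (1 + x j) - 1)) *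
        ∏ i, ∏ j ∈ Ioi i, (w i * w j) := by
  simp only [Matrix.det_vandermonde, ← Finset.prod_mul_distrib]
  refine Finset.prod_congr rfl fun i _ => Finset.prod_congr rfl fun j _ => ?_
  linear_combination (-(1 + x j) ^ 2 * w j + (1 + x i) * (1 + x j) * w j - w j) * h i +
    (-(1 + x j) + w i + (1 + x i)) * h j

variable {K : Type*} [CommRing K]

/-- The product of the weights of all pairs among the first `n` variables. -/
noncomputable def pairProd (Q : K) (n : ℕ) : MvPolynomial ℕ K :=
  ∏ i ∈ range n, ∏ j ∈ range i, pairWeight (MvPolynomial.C Q) (MvPolynomial.X j) (MvPolynomial.X i)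

theorem aeval_pairProd {A : Type*} [CommRing A] [Algebra K A] (Q : K) (n : ℕ) (v : ℕ → A) :
    MvPolynomial.aeval v (pairProd Q n) =
      ∏ i ∈ range n, ∏ j ∈ range i, pairWeight (algebraMap K A Q) (v j) (v i) := by
  simp [pairProd, pairWeight]

theorem asym_odd {A : Type*} [CommRing A] [Algebra K A] (Q : K) : ∀ (n : ℕ) (u : Fin n → A),
    asym n (fun v => MvPolynomial.aeval v
      ((∏ i ∈ range n, MvPolynomial.X i ^ (2 * i + 1)) * pairProd Q n)) u =
      oddAsym (algebraMap K A Q) n u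
  | 0, u => by simp [asym, oddAsym, pairProd]
  | n + 1, u => by
    simp only [asym, oddAsym, ← asym_odd Q n]
    refine Finset.sum_congr rfl fun k _ => ?_
    have := asym_mul_prod n (fun v => MvPolynomial.aeval v
      ((∏ i ∈ range n, MvPolynomial.X i ^ (2 * i + 1)) * pairProd Q n)) (u ∘ k.succAbove)
      (u k ^ (2 * n + 1)) (fun a => pairWeight (algebraMap K A Q) a (u k))
    simp only [Function.comp_apply] at this
    rw [← this]
    congr 2
    ext v
    simp only [map_mul, aeval_pairProd, map_prod, map_pow, MvPolynomial.aeval_X,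
      Finset.prod_range_succ _ n, Function.update_self]
    have h : ∀ i < n, Function.update v n (u k) i = v i := fun i hi =>
      Function.update_of_ne (by omega) _ _
    have e1 : ∏ i ∈ range n, Function.update v n (u k) i ^ (2 * i + 1) =
        ∏ i ∈ range n, v i ^ (2 * i + 1) :=
      Finset.prod_congr rfl fun i hi => by rw [h i (Finset.mem_range.1 hi)]
    have e2 : ∏ i ∈ range n, ∏ j ∈ range i, pairWeight (algebraMap K A Q)
        (Function.update v n (u k) j) (Function.update v n (u k) i) =
        ∏ i ∈ range n, ∏ j ∈ range i, pairWeight (algebraMap K A Q) (v j) (v i) :=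
      Finset.prod_congr rfl fun i hi => Finset.prod_congr rfl fun j hj => by
        have h1 := Finset.mem_range.1 hi
        have h2 := Finset.mem_range.1 hj
        rw [h i h1, h j (h2.trans h1)]
    have e3 : ∏ i ∈ range n, pairWeight (algebraMap K A Q) (Function.update v n (u k) i) (u k) =
        ∏ i ∈ range n, pairWeight (algebraMap K A Q) (v i) (u k) :=
      Finset.prod_congr rfl fun i hi => by rw [h i (Finset.mem_range.1 hi)]
    rw [e1, e2, e3]
    ring

theorem binomDet_odd [IsDomain K] [CharZero K] {Q : K} (hQ : Q ≠ 0) (n : ℕ) :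
    binomDet K n 0 ((∏ i ∈ range n, MvPolynomial.X i ^ (2 * i + 1)) * pairProd Q n) =
      (Matrix.of fun i j : Fin n => (rPoly Q i).coeff j).det := by
  let φ : PowerSeries K →ₐ[K] K :=
    { PowerSeries.constantCoeff (R := K) with commutes' := fun r => by simp }
  have φdef : ∀ a, φ a = PowerSeries.constantCoeff a := fun a => rfl
  let x : Fin n → PowerSeries K := fun i => PowerSeries.C ((i : K) + 1) * PowerSeries.X
  have hx : ∀ i, φ (x i) = 0 := fun i => by simp [φdef, x]
  have hw : ∀ i, ∃ w, (1 + x i) * w = 1 := fun i => by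
    have : IsUnit (1 + x i) := by
      rw [PowerSeries.isUnit_iff_constantCoeff]; simp [x]
    exact this.exists_right_inv
  choose w hw using hw
  have hφw : ∀ i, φ (w i) = 1 := fun i => by
    simpa [hx] using congrArg φ (hw i)
  have hx1 : ∀ i, PowerSeries.coeff 1 (x i) = (i : K) + 1 := fun i => by
    simp [x]
  have hne : ∀ i j, (1 + x i) * (1 + x j) - 1 ≠ 0 := fun i j h => by
    rw [show (1 + x i) * (1 + x j) - 1 = x i + x j + x i * x j by ring] at h
    have h1 := congrArg (PowerSeries.coeff 1) h
    rw [show x i * x j = PowerSeries.C (((i : K) + 1) * (j + 1)) * PowerSeries.X ^ 2 by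
      simp only [x, map_mul]; ring] at h1
    simp only [map_add, hx1, PowerSeries.coeff_C_mul, PowerSeries.coeff_X_pow, map_zero] at h1
    rw [if_neg (by norm_num), mul_zero, add_zero] at h1
    have : ((i + 1 + (j + 1) : ℕ) : K) = 0 := by push_cast; exact h1
    rw [Nat.cast_eq_zero] at this
    omega
  have hy : ∀ i, 1 + x i + w i + (algebraMap K (PowerSeries K) Q - 2) ≠ 0 := fun i h => by
    have h1 := congrArg φ h
    simp only [map_add, map_sub, map_one, hx, hφw, map_ofNat, map_zero, AlgHom.commutes,
      Algebra.algebraMap_self, RingHom.id_apply] at h1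
    exact hQ (by linear_combination h1)
  have hV : (Matrix.vandermonde x).det ≠ 0 := by
    rw [Matrix.det_vandermonde_ne_zero_iff]
    intro i j hij
    have h1 := congrArg (PowerSeries.coeff 1) hij
    rw [hx1, hx1] at h1
    exact Fin.ext (Nat.cast_injective (add_right_cancel h1))
  obtain ⟨S, hS, hφS⟩ := exists_asym_eq_vandermonde_mul φ
    ((∏ i ∈ range n, MvPolynomial.X i ^ (2 * i + 1)) * pairProd Q n) x hx
  obtain ⟨S', hS', hφS'⟩ := exists_det_eval_eq_vandermonde_mul φ
    (fun j : Fin n => rPoly Q j) (fun i => 1 + x i + w i - 2)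
    (fun i => by simp only [map_add, map_sub, map_one, hx, hφw, map_ofNat]; norm_num)
  have key := oddAsym_mul_prod_eq_det (algebraMap K (PowerSeries K) Q) (fun i => 1 + x i) w hw
    (fun i => hne i i) hy
  have hr : ∀ i j : Fin n, aeval (1 + x i + w i - 2) (rPoly Q j) =
      lucasSeq ((1 + x i + w i - 2) ^ 2 +
        (2 + algebraMap K (PowerSeries K) Q) * (1 + x i + w i - 2))
        (-((1 + x i + w i - 2) * ((algebraMap K (PowerSeries K) Q - 1) * (1 + x i + w i - 2) +
          algebraMap K (PowerSeries K) Q ^ 2))) j := by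
    intro i j
    have := map_lucasSeq (aeval (R := K) (1 + x i + w i - 2)).toRingHom
      (X ^ 2 + C (2 + Q) * X) (-(X * (C (Q - 1) * X + C (Q ^ 2)))) j
    refine this.trans ?_
    simp [show PowerSeries.C (2 : K) = 2 from map_ofNat _ 2]
  simp only [hr] at hS'
  rw [hS', det_vandermonde_reciprocal x w hw, ← asym_odd, hS] at key
  have hP : ∏ i, ∏ j ∈ Ioi i, ((1 + x i) * (1 + x j) - 1) ≠ 0 :=
    Finset.prod_ne_zero_iff.2 fun i _ => Finset.prod_ne_zero_iff.2 fun j _ => hne i j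
  have hSS : S = (∏ i, (1 + x i)) ^ (2 * n) * (∏ i, w i) * (∏ i, ∏ j ∈ Ioi i, (w i * w j)) * S' :=
    mul_left_cancel₀ hV (mul_right_cancel₀ hP (by linear_combination key))
  have := congrArg φ hSS
  simp only [map_mul, map_prod, map_pow, map_add, map_one, hx, hφw, hφS, hφS'] at this
  simpa [← Matrix.det_transpose (Matrix.of fun i j : Fin n => (rPoly Q i).coeff j),
    Matrix.transpose] using this

end OddMinor

section Functional

open MvPolynomial (rename aeval)

variable {K : Type*} [CommRing K]

theorem binomDet_congr {n : ℕ} {s t : ℕ → ℕ} (h : ∀ i < n, s i = t i) :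
    binomDet K n s = binomDet K n t := by
  simp only [binomDet]
  congr 1
  ext k
  congr 1
  ext i j
  simp [h i i.2]

theorem binomDet_X_sub_one_mul {n m : ℕ} (hm : m < n) (s : ℕ → ℕ) (G : MvPolynomial ℕ K) :
    binomDet K n (Function.update s m (s m + 1)) ((MvPolynomial.X m - 1) * G) =
      binomDet K n s G := by
  induction G using MvPolynomial.induction_on' with
  | add p q hp hq => rw [mul_add, map_add, hp, hq, map_add]
  | monomial k c =>
    have h1 : (MvPolynomial.X m - 1) * MvPolynomial.monomial k c =
        MvPolynomial.monomial (Finsupp.single m 1 + k) c - MvPolynomial.monomial k c := by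
      rw [sub_mul, one_mul, MvPolynomial.X, MvPolynomial.monomial_mul, one_mul]
    rw [h1, map_sub, binomDet_monomial, binomDet_monomial, binomDet_monomial, ← mul_sub]
    congr 1
    set M := Matrix.of fun i j : Fin n => ((k i).choose (j + s i) : K) with hM
    have e1 : (Matrix.of fun i j : Fin n => (((Finsupp.single m 1 + k : ℕ →₀ ℕ) i).choose
        (j + Function.update s m (s m + 1) i) : K)) = M.updateRow ⟨m, hm⟩
        (fun j => ((k m).choose (j + s m) : K) + ((k m).choose (j + s m + 1) : K)) := by
      ext i j
      rcases eq_or_ne i ⟨m, hm⟩ with rfl | hi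
      · simp [add_comm 1 (k m), ← add_assoc, Nat.choose_succ_succ]
      · have : (i : ℕ) ≠ m := fun h => hi (Fin.ext h)
        simp [hM, Matrix.updateRow_ne hi, Function.update_of_ne this,
          Finsupp.single_eq_of_ne this]
    have e2 : (Matrix.of fun i j : Fin n => ((k i).choose
        (j + Function.update s m (s m + 1) i) : K)) = M.updateRow ⟨m, hm⟩
        (fun j => ((k m).choose (j + s m + 1) : K)) := by
      ext i j
      rcases eq_or_ne i ⟨m, hm⟩ with rfl | hi
      · simp [← add_assoc]
      · have : (i : ℕ) ≠ m := fun h => hi (Fin.ext h)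
        simp [hM, Matrix.updateRow_ne hi, Function.update_of_ne this]
    have e3 : M = M.updateRow ⟨m, hm⟩ (fun j => ((k m).choose (j + s m) : K)) := by
      ext i j
      rcases eq_or_ne i ⟨m, hm⟩ with rfl | hi
      · simp [hM]
      · simp [Matrix.updateRow_ne hi]
    have e4 := Matrix.det_updateRow_add M ⟨m, hm⟩ (fun j : Fin n => ((k m).choose (j + s m) : K))
      (fun j : Fin n => ((k m).choose (j + s m + 1) : K))
    rw [← e3, ← e2] at e4
    rw [e1, sub_eq_iff_eq_add]
    exact e4

theorem binomDet_prod_X_sub_one_mul (n : ℕ) (G : MvPolynomial ℕ K) :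
    binomDet K n 1 ((∏ i ∈ range n, (MvPolynomial.X i - 1)) * G) = binomDet K n 0 G := by
  have h : ∀ c ≤ n, binomDet K n (fun i => if i < c then 1 else 0)
      ((∏ i ∈ range c, (MvPolynomial.X i - 1)) * G) = binomDet K n 0 G := by
    intro c hc
    induction c with
    | zero => simp; rfl
    | succ c ih =>
      have e : Function.update (fun i => if i < c then 1 else 0) c
          ((if c < c then 1 else 0) + 1) = fun i => if i < c + 1 then 1 else 0 := by
        ext i
        rcases eq_or_ne i c with rfl | hi
        · simp
        · rw [Function.update_of_ne hi]
          congr 1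
          rw [eq_iff_iff]
          omega
      have := binomDet_X_sub_one_mul (m := c) (n := n) (by omega)
        (fun i => if i < c then 1 else 0) ((∏ i ∈ range c, (MvPolynomial.X i - 1)) * G)
      rw [e, ← mul_assoc, ih (by omega)] at this
      rw [← this, Finset.prod_range_succ, mul_comm (∏ i ∈ range c, _)]
  rw [← h n le_rfl]
  congr 1
  exact binomDet_congr fun i hi => by simp [hi]

theorem binomDet_rename_swap {n j : ℕ} (hj : j + 1 < n) (a : ℕ) (G : MvPolynomial ℕ K) :
    binomDet K n (fun _ => a) (rename (Equiv.swap j (j + 1)) G) =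
      -binomDet K n (fun _ => a) G := by
  induction G using MvPolynomial.induction_on' with
  | add p q hp hq => rw [map_add, map_add, hp, hq, map_add, neg_add]
  | monomial k c =>
    rw [MvPolynomial.rename_monomial, binomDet_monomial, binomDet_monomial, ← mul_neg]
    congr 1
    have hne : (⟨j, by omega⟩ : Fin n) ≠ ⟨j + 1, hj⟩ := by simp
    have := Matrix.det_permute (Equiv.swap (⟨j, by omega⟩ : Fin n) ⟨j + 1, hj⟩)
      (Matrix.of fun i l : Fin n => ((k i).choose (l + a) : K))
    rw [Equiv.Perm.sign_swap hne] at this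
    simp only [Units.val_neg, Units.val_one, Int.cast_neg, Int.cast_one, neg_mul, one_mul] at this
    rw [← this]
    congr 1
    ext i l
    simp only [Matrix.of_apply, Matrix.submatrix_apply, id]
    have h1 : ∀ i : ℕ, (Finsupp.mapDomain (Equiv.swap j (j + 1)) k) i =
        k (Equiv.swap j (j + 1) i) := fun i => by
      have := Finsupp.mapDomain_apply (Equiv.swap j (j + 1)).injective k (Equiv.swap j (j + 1) i)
      rwa [Equiv.swap_apply_self] at this
    have h2 : ((Equiv.swap (⟨j, by omega⟩ : Fin n) ⟨j + 1, hj⟩ i : Fin n) : ℕ) =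
        Equiv.swap j (j + 1) i := by
      simp only [Equiv.swap_apply_def, Fin.ext_iff]
      split_ifs <;> rfl
    rw [h1, h2]

theorem binomDet_eq_zero_of_rename_swap [IsDomain K] [CharZero K] {n j : ℕ} (hj : j + 1 < n)
    (a : ℕ) {G : MvPolynomial ℕ K} (hG : rename (Equiv.swap j (j + 1)) G = G) :
    binomDet K n (fun _ => a) G = 0 := by
  have := binomDet_rename_swap hj a G
  rw [hG] at this
  exact self_eq_neg.1 this

/-- Setting the variable of index `m` to `1` and shifting down the later variables. -/
noncomputable def dropVar (K : Type*) [CommRing K] (m : ℕ) :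
    MvPolynomial ℕ K →ₐ[K] MvPolynomial ℕ K :=
  aeval fun i => if i < m then MvPolynomial.X i else if i = m then 1 else MvPolynomial.X (i - 1)

theorem dropVar_X_of_lt {m i : ℕ} (h : i < m) :
    dropVar K m (MvPolynomial.X i) = MvPolynomial.X i := by
  simp [dropVar, h]

theorem dropVar_X_self (m : ℕ) : dropVar K m (MvPolynomial.X m) = 1 := by
  simp [dropVar]

theorem dropVar_X_of_gt {m i : ℕ} (h : m < i) :
    dropVar K m (MvPolynomial.X i) = MvPolynomial.X (i - 1) := by
  simp [dropVar, h.not_gt, h.ne']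

theorem skip_injective (m : ℕ) : Function.Injective fun i => if i < m then i else i + 1 := by
  intro a b h
  simp only at h
  split_ifs at h <;> omega

/-- Deletion of the entry of index `m` of an exponent vector. -/
noncomputable def dropExponent (m : ℕ) (k : ℕ →₀ ℕ) : ℕ →₀ ℕ :=
  k.comapDomain (fun i => if i < m then i else i + 1) (skip_injective m).injOn

theorem dropExponent_apply (m : ℕ) (k : ℕ →₀ ℕ) (l : ℕ) :
    dropExponent m k l = k (if l < m then l else l + 1) := by
  rw [dropExponent, Finsupp.comapDomain_apply]

theorem dropVar_monomial (m : ℕ) (k : ℕ →₀ ℕ) (c : K) :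
    dropVar K m (MvPolynomial.monomial k c) = 
      MvPolynomial.monomial (dropExponent m k) c := by
  have h1 : ∀ k : ℕ →₀ ℕ, dropVar K m (MvPolynomial.monomial k 1) = 
      MvPolynomial.monomial (dropExponent m k) 1 := by
    intro k
    induction k using Finsupp.induction_linear with
    | zero =>
      rw [show (MvPolynomial.monomial (0 : ℕ →₀ ℕ) (1 : K)) = 1 from rfl, map_one,
        show dropExponent m 0 = 0 by ext l; simp [dropExponent_apply]]
      rfl
    | add f g hf hg =>
      rw [← one_mul (1 : K), ← MvPolynomial.monomial_mul, map_mul, hf, hg,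
        MvPolynomial.monomial_mul, one_mul]
      refine congrArg (fun k => MvPolynomial.monomial k (1 : K)) ?_
      ext l
      simp [dropExponent_apply]
    | single i b =>
      rw [← MvPolynomial.X_pow_eq_monomial, map_pow]
      rcases lt_trichotomy i m with h | h | h
      · rw [dropVar_X_of_lt h, MvPolynomial.X_pow_eq_monomial]
        refine congrArg (fun k => MvPolynomial.monomial k (1 : K)) ?_
        ext l
        simp only [dropExponent_apply, Finsupp.single_apply]
        congr 1
        rw [eq_iff_iff]
        split_ifs <;> omega
      · rw [h, dropVar_X_self, one_pow, show (1 : MvPolynomial ℕ K) = MvPolynomial.monomial 0 1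
          from rfl]
        refine congrArg (fun k => MvPolynomial.monomial k (1 : K)) ?_
        ext l
        simp only [dropExponent_apply, Finsupp.single_apply, Finsupp.coe_zero,
          Pi.zero_apply]
        rw [if_neg]
        split_ifs <;> omega
      · rw [dropVar_X_of_gt h, MvPolynomial.X_pow_eq_monomial]
        refine congrArg (fun k => MvPolynomial.monomial k (1 : K)) ?_
        ext l
        simp only [dropExponent_apply, Finsupp.single_apply]
        congr 1
        rw [eq_iff_iff]
        split_ifs <;> omega
  have h2 := h1 k
  rw [show MvPolynomial.monomial k c = c • MvPolynomial.monomial k (1 : K) by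
    simp [MvPolynomial.smul_monomial], map_smul, h2]
  simp [MvPolynomial.smul_monomial]

theorem binomDet_succ_eq_sum_dropVar (n : ℕ) (G : MvPolynomial ℕ K) :
    binomDet K (n + 1) 0 G = ∑ m ∈ range (n + 1), (-1) ^ m * binomDet K n 1 (dropVar K m G) := by
  induction G using MvPolynomial.induction_on' with
  | add p q hp hq => simp only [map_add, hp, hq, mul_add, Finset.sum_add_distrib]
  | monomial k c =>
    rw [binomDet_monomial, Matrix.det_succ_column_zero, Finset.mul_sum, Finset.sum_range]
    refine Finset.sum_congr rfl fun m _ => ?_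
    rw [dropVar_monomial, binomDet_monomial]
    simp only [Matrix.of_apply, Fin.val_zero, Pi.zero_apply, add_zero, Nat.choose_zero_right,
      Nat.cast_one, mul_one]
    rw [mul_left_comm]
    congr 3
    ext i j
    simp only [Matrix.submatrix_apply, Matrix.of_apply, Fin.val_succ, Pi.one_apply]
    rw [dropExponent_apply]
    congr 3
    split_ifs with h
    · rw [Fin.succAbove_of_castSucc_lt _ _ h, Fin.val_castSucc]
    · rw [Fin.succAbove_of_le_castSucc _ _ (not_lt.1 h), Fin.val_succ]

theorem prod_range_succ_dropVar {m c : ℕ} (h : m ≤ c)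
    (g : MvPolynomial ℕ K → MvPolynomial ℕ K) :
    ∏ i ∈ range (c + 1), g (dropVar K m (MvPolynomial.X i)) =
      (∏ i ∈ range c, g (MvPolynomial.X i)) * g 1 := by
  induction c, h using Nat.le_induction with
  | base =>
    rw [Finset.prod_range_succ, dropVar_X_self]
    congr 1
    exact Finset.prod_congr rfl fun i hi => by rw [dropVar_X_of_lt (Finset.mem_range.1 hi)]
  | succ c hc ih =>
    rw [Finset.prod_range_succ, ih, Finset.prod_range_succ, dropVar_X_of_gt (by omega),
      Nat.add_sub_cancel, mul_right_comm]

theorem map_pairWeight {R S F : Type*} [CommRing R] [CommRing S] [FunLike F R S]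
    [RingHomClass F R S] (f : F) (Q u v : R) :
    f (pairWeight Q u v) = pairWeight (f Q) (f u) (f v) := by
  simp [pairWeight, show f 2 = 2 from map_ofNat f 2]

theorem dropVar_C (m : ℕ) (a : K) : dropVar K m (MvPolynomial.C a) = MvPolynomial.C a := by
  simp [dropVar]

theorem pairProd_succ (Q : K) (n : ℕ) : pairProd Q (n + 1) = pairProd Q n *
    ∏ j ∈ range n, pairWeight (MvPolynomial.C Q) (MvPolynomial.X j) (MvPolynomial.X n) := by
  rw [pairProd, Finset.prod_range_succ, ← pairProd]

theorem dropVar_pairProd_of_le (Q : K) {m c : ℕ} (h : c ≤ m) :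
    dropVar K m (pairProd Q c) = pairProd Q c := by
  induction c with
  | zero => simp [pairProd]
  | succ c ih =>
    rw [pairProd_succ, map_mul, ih (by omega), map_prod]
    congr 1
    refine Finset.prod_congr rfl fun i hi => ?_
    have := Finset.mem_range.1 hi
    rw [map_pairWeight, dropVar_C, dropVar_X_of_lt (by omega), dropVar_X_of_lt (by omega)]

theorem dropVar_pairProd_succ (Q : K) {m c : ℕ} (h : m ≤ c) :
    dropVar K m (pairProd Q (c + 1)) = pairProd Q c *
      ((∏ i ∈ range m, pairWeight (MvPolynomial.C Q) (MvPolynomial.X i) 1) *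
        ∏ i ∈ Ico m c, pairWeight (MvPolynomial.C Q) 1 (MvPolynomial.X i)) := by
  induction c, h using Nat.le_induction with
  | base =>
    rw [pairProd_succ, map_mul, dropVar_pairProd_of_le Q le_rfl, map_prod]
    simp only [Finset.Ico_self, Finset.prod_empty, mul_one]
    congr 1
    refine Finset.prod_congr rfl fun i hi => ?_
    rw [map_pairWeight, dropVar_C, dropVar_X_of_lt (Finset.mem_range.1 hi), dropVar_X_self]
  | succ c hc ih =>
    rw [pairProd_succ, map_mul, ih, map_prod, Finset.prod_Ico_succ_top hc, pairProd_succ]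
    simp only [map_pairWeight, dropVar_C]
    rw [prod_range_succ_dropVar hc (fun y => pairWeight (MvPolynomial.C Q) y
      (dropVar K m (MvPolynomial.X (c + 1)))), dropVar_X_of_gt (by omega), Nat.add_sub_cancel]
    ring

/-- The span of the polynomials `g * pairWeight (X (j+1)) (X j)`, with `j + 1 < c` and `g`
symmetric in `X j` and `X (j+1)`. -/
noncomputable def swapSpan (Q : K) (c : ℕ) : Submodule K (MvPolynomial ℕ K) :=
  Submodule.span K {p | ∃ j g, j + 1 < c ∧ rename (Equiv.swap j (j + 1)) g = g ∧
    p = g * pairWeight (MvPolynomial.C Q) (MvPolynomial.X (j + 1)) (MvPolynomial.X j)}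

theorem swapSpan_mono (Q : K) {c d : ℕ} (h : c ≤ d) : swapSpan Q c ≤ swapSpan Q d :=
  Submodule.span_mono fun _ ⟨j, g, hj, hg⟩ => ⟨j, g, by omega, hg⟩

theorem mul_mem_swapSpan {Q : K} {c : ℕ} {p h : MvPolynomial ℕ K} (hp : p ∈ swapSpan Q c)
    (hh : ∀ j, j + 1 < c → rename (Equiv.swap j (j + 1)) h = h) : p * h ∈ swapSpan Q c := by
  induction hp using Submodule.span_induction with
  | mem p hp =>
    obtain ⟨j, g, hj, hg, rfl⟩ := hp
    exact Submodule.subset_span ⟨j, g * h, hj, by rw [map_mul, hg, hh j hj], by ring⟩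
  | zero => simp
  | add p q _ _ hp hq => rw [add_mul]; exact Submodule.add_mem _ hp hq
  | smul a p _ hp => rw [smul_mul_assoc]; exact Submodule.smul_mem _ a hp

theorem rename_pairProd_of_forall_lt (Q : K) {c : ℕ} {σ : ℕ → ℕ} (h : ∀ i < c, σ i = i) :
    rename σ (pairProd Q c) = pairProd Q c := by
  simp only [pairProd, map_prod]
  refine Finset.prod_congr rfl fun i hi => Finset.prod_congr rfl fun j hj => ?_
  have h1 := Finset.mem_range.1 hi
  have h2 := Finset.mem_range.1 hj
  rw [map_pairWeight, MvPolynomial.rename_C, MvPolynomial.rename_X, MvPolynomial.rename_X,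
    h i h1, h j (by omega)]

theorem rename_swap_pairProd_mul (Q : K) {j n : ℕ} (hj : j + 2 ≤ n) :
    rename (Equiv.swap j (j + 1)) (pairProd Q n *
      pairWeight (MvPolynomial.C Q) (MvPolynomial.X (j + 1)) (MvPolynomial.X j)) =
    pairProd Q n *
      pairWeight (MvPolynomial.C Q) (MvPolynomial.X (j + 1)) (MvPolynomial.X j) := by
  have hs : ∀ i < j, Equiv.swap j (j + 1) i = i := fun i hi =>
    Equiv.swap_apply_of_ne_of_ne (by omega) (by omega)
  induction n, hj using Nat.le_induction with
  | base =>
    simp only [pairProd_succ, map_mul, map_prod, map_pairWeight, MvPolynomial.rename_C,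
      MvPolynomial.rename_X, rename_pairProd_of_forall_lt Q hs, Finset.prod_range_succ,
      Equiv.swap_apply_left, Equiv.swap_apply_right]
    have e : ∀ l, ∏ i ∈ range j, pairWeight (MvPolynomial.C Q)
        (MvPolynomial.X (Equiv.swap j (j + 1) i)) (MvPolynomial.X l : MvPolynomial ℕ K) =
        ∏ i ∈ range j, pairWeight (MvPolynomial.C Q) (MvPolynomial.X i) (MvPolynomial.X l) :=
      fun l => Finset.prod_congr rfl fun i hi => by rw [hs i (Finset.mem_range.1 hi)]
    rw [e, e]
    ring
  | succ n hn ih =>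
    rw [pairProd_succ, mul_right_comm, map_mul, ih, map_prod]
    congr 1
    simp only [map_pairWeight, MvPolynomial.rename_C, MvPolynomial.rename_X]
    rw [Equiv.swap_apply_of_ne_of_ne (show n ≠ j by omega) (show n ≠ j + 1 by omega)]
    refine Equiv.Perm.prod_comp (Equiv.swap j (j + 1)) (range n) (fun i =>
      pairWeight (MvPolynomial.C Q) (MvPolynomial.X i) (MvPolynomial.X n)) fun i hi => ?_
    have hi : Equiv.swap j (j + 1) i ≠ i := hi
    have : i = j ∨ i = j + 1 := by
      by_contra! h
      exact hi (Equiv.swap_apply_of_ne_of_ne h.1 h.2)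
    simp only [Finset.coe_range, Set.mem_Iio]
    omega

theorem binomDet_mul_pairProd_eq_zero [IsDomain K] [CharZero K] {Q : K} {n : ℕ} (a : ℕ)
    {p : MvPolynomial ℕ K} (hp : p ∈ swapSpan Q n) :
    binomDet K n (fun _ => a) (p * pairProd Q n) = 0 := by
  induction hp using Submodule.span_induction with
  | mem p hp =>
    obtain ⟨j, g, hj, hg, rfl⟩ := hp
    refine binomDet_eq_zero_of_rename_swap hj a ?_
    rw [mul_assoc, map_mul, hg, mul_comm (pairWeight _ _ _), rename_swap_pairProd_mul Q hj]
  | zero => simp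
  | add p q _ _ hp hq => rw [add_mul, map_add, hp, hq, add_zero]
  | smul b p _ hp => rw [smul_mul_assoc, map_smul, hp, smul_zero]

end Functional

section Scan

open MvPolynomial (rename)

/-- The number of elements of `S` below `p`. -/
def countBelow (S : Finset ℕ) (p : ℕ) : ℕ := #{i ∈ range p | i ∈ S}

theorem countBelow_zero (S : Finset ℕ) : countBelow S 0 = 0 := rfl

theorem countBelow_succ (S : Finset ℕ) (p : ℕ) :
    countBelow S (p + 1) = countBelow S p + if p ∈ S then 1 else 0 := by
  rw [countBelow, Finset.range_add_one, Finset.filter_insert]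
  split_ifs with h
  · rw [Finset.card_insert_of_notMem (by simp), countBelow]
  · rfl

theorem countBelow_insert {t : Finset ℕ} {p i : ℕ} (h : i ≤ p) :
    countBelow (insert p t) i = countBelow t i := by
  rw [countBelow, countBelow]
  congr 1
  refine Finset.filter_congr fun j hj => ?_
  have := Finset.mem_range.1 hj
  simp [show j ≠ p by omega]

theorem countBelow_mono (S : Finset ℕ) : Monotone (countBelow S) := fun _ _ h =>
  Finset.card_le_card (Finset.filter_subset_filter _ (Finset.range_subset_range.2 h))

theorem countBelow_lt {S : Finset ℕ} {i p : ℕ} (h : i < p) (hi : i ∈ S) :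
    countBelow S i < countBelow S p := by
  have h1 := countBelow_mono S (Nat.succ_le_of_lt h)
  rw [Nat.succ_eq_add_one, countBelow_succ, if_pos hi] at h1
  omega

/-- Every prefix up to `p` contains as many elements of `S` as of `t`, or one more. -/
def Interlaces (t S : Finset ℕ) (p : ℕ) : Prop :=
  ∀ i ≤ p, countBelow t i ≤ countBelow S i ∧ countBelow S i ≤ countBelow t i + 1

instance (t S : Finset ℕ) (p : ℕ) : Decidable (Interlaces t S p) := by
  unfold Interlaces; infer_instance

theorem interlaces_zero (t S : Finset ℕ) : Interlaces t S 0 := by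
  intro i hi
  rw [Nat.le_zero.1 hi]
  simp [countBelow_zero]

theorem interlaces_succ {t S : Finset ℕ} {p : ℕ} : Interlaces t S (p + 1) ↔ Interlaces t S p ∧
    countBelow t (p + 1) ≤ countBelow S (p + 1) ∧
    countBelow S (p + 1) ≤ countBelow t (p + 1) + 1 := by
  refine ⟨fun h => ⟨fun i hi => h i (by omega), h _ le_rfl⟩, fun h i hi => ?_⟩
  rcases Nat.le_succ_iff.1 hi with hi | rfl
  · exact h.1 i hi
  · exact h.2

theorem interlaces_insert {t S : Finset ℕ} {p : ℕ} :
    Interlaces (insert p t) S p ↔ Interlaces t S p := by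
  refine forall₂_congr fun i hi => ?_
  rw [countBelow_insert hi]

variable {K : Type*} [CommRing K]

/-- The monomial whose exponents are the elements of `S` below `p`, in increasing order. -/
noncomputable def markMono (K : Type*) [CommRing K] (S : Finset ℕ) (p : ℕ) : MvPolynomial ℕ K :=
  ∏ i ∈ range p, if i ∈ S then MvPolynomial.X (countBelow S i) ^ i else 1

theorem markMono_succ (S : Finset ℕ) (p : ℕ) : markMono K S (p + 1) =
    markMono K S p * if p ∈ S then MvPolynomial.X (countBelow S p) ^ p else 1 :=
  Finset.prod_range_succ _ _

theorem markMono_insert (t : Finset ℕ) (p : ℕ) :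
    markMono K (insert p t) p = markMono K t p := by
  refine Finset.prod_congr rfl fun i hi => ?_
  have := Finset.mem_range.1 hi
  rw [countBelow_insert this.le]
  simp [this.ne]

/-- The product of a factor `Q` for every element of `t \ S` below `p`. -/
def diffWeight (Q : K) (S t : Finset ℕ) (p : ℕ) : K :=
  ∏ i ∈ range p, if i ∈ t ∧ i ∉ S then Q else 1

theorem diffWeight_succ (Q : K) (S t : Finset ℕ) (p : ℕ) : diffWeight Q S t (p + 1) =
    diffWeight Q S t p * if p ∈ t ∧ p ∉ S then Q else 1 :=
  Finset.prod_range_succ _ _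

theorem diffWeight_insert (Q : K) (S t : Finset ℕ) (p : ℕ) :
    diffWeight Q S (insert p t) p = diffWeight Q S t p := by
  refine Finset.prod_congr rfl fun i hi => ?_
  have := Finset.mem_range.1 hi
  simp [this.ne]

/-- The contribution of `t` to the scan of `S` up to position `p`. -/
noncomputable def scanTerm (Q : K) (S t : Finset ℕ) (p : ℕ) : MvPolynomial ℕ K :=
  MvPolynomial.C (diffWeight Q S t p) * markMono K t p *
    ∏ i ∈ range (countBelow t p), (MvPolynomial.X i - 1)

theorem scanTerm_succ (Q : K) (S : Finset ℕ) {t : Finset ℕ} {p : ℕ} (hp : p ∉ t) :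
    scanTerm Q S t (p + 1) = scanTerm Q S t p := by
  simp [scanTerm, diffWeight_succ, markMono_succ, countBelow_succ, hp]

theorem scanTerm_insert (Q : K) (S t : Finset ℕ) (p : ℕ) :
    scanTerm Q S (insert p t) (p + 1) = scanTerm Q S t p *
      (MvPolynomial.C (if p ∈ S then 1 else Q) * (MvPolynomial.X (countBelow t p) ^ p *
        (MvPolynomial.X (countBelow t p) - 1))) := by
  simp only [scanTerm, diffWeight_succ, markMono_succ, countBelow_succ, Finset.mem_insert,
    true_or, if_true, true_and, countBelow_insert le_rfl, markMono_insert, diffWeight_insert,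
    Finset.prod_range_succ, map_mul]
  by_cases h : p ∈ S <;> simp [h] <;> ring

/-- The sum of the contributions of the sets interlacing with `S` up to position `p`, with `d`
elements less than `S`. -/
noncomputable def scanSum (Q : K) (S : Finset ℕ) (d p : ℕ) : MvPolynomial ℕ K :=
  ∑ t ∈ (range p).powerset,
    if Interlaces t S p ∧ countBelow S p = countBelow t p + d then scanTerm Q S t p else 0

theorem scanSum_succ (Q : K) (S : Finset ℕ) (d p : ℕ) : scanSum Q S d (p + 1) =
    ∑ t ∈ (range p).powerset,
      ((if Interlaces t S (p + 1) ∧ countBelow S (p + 1) = countBelow t p + d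
          then scanTerm Q S t p else 0) +
        if Interlaces (insert p t) S (p + 1) ∧ countBelow S (p + 1) = countBelow t p + 1 + d
          then scanTerm Q S t p * (MvPolynomial.C (if p ∈ S then 1 else Q) *
            (MvPolynomial.X (countBelow t p) ^ p * (MvPolynomial.X (countBelow t p) - 1)))
          else 0) := by
  rw [scanSum, Finset.range_add_one, Finset.sum_powerset_insert (by simp),
    ← Finset.sum_add_distrib]
  refine Finset.sum_congr rfl fun t ht => ?_
  have hp : p ∉ t := fun h => by simpa using Finset.mem_powerset.1 ht h
  rw [scanTerm_succ Q S hp, scanTerm_insert, countBelow_succ t, countBelow_succ (insert p t),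
    countBelow_insert le_rfl]
  simp [hp]

theorem scanSum_zero_succ_of_notMem (Q : K) {S : Finset ℕ} {p : ℕ} (hp : p ∉ S) :
    scanSum Q S 0 (p + 1) = scanSum Q S 0 p + scanSum Q S 1 p *
      (MvPolynomial.C Q * (MvPolynomial.X (countBelow S p - 1) ^ p *
        (MvPolynomial.X (countBelow S p - 1) - 1))) := by
  rw [scanSum_succ, scanSum, scanSum, Finset.sum_mul, ← Finset.sum_add_distrib]
  refine Finset.sum_congr rfl fun t ht => ?_
  have hpt : p ∉ t := fun h => by simpa using Finset.mem_powerset.1 ht h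
  simp only [interlaces_succ, countBelow_succ, interlaces_insert, countBelow_insert le_rfl, hp,
    hpt, if_false, Finset.mem_insert_self, if_true, add_zero, ite_mul, zero_mul]
  congr 1
  · congr 1
    rw [eq_iff_iff]
    constructor
    · rintro ⟨⟨h1, -⟩, h2⟩; exact ⟨h1, h2⟩
    · rintro ⟨h1, h2⟩; exact ⟨⟨h1, by omega⟩, h2⟩
  · by_cases h : Interlaces t S p ∧ countBelow S p = countBelow t p + 1
    · rw [if_pos h, if_pos ⟨⟨h.1, by omega⟩, h.2⟩, h.2, Nat.add_sub_cancel]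
    · rw [if_neg h, if_neg fun h' => h ⟨h'.1.1, h'.2⟩]

theorem scanSum_one_succ_of_notMem (Q : K) {S : Finset ℕ} {p : ℕ} (hp : p ∉ S) :
    scanSum Q S 1 (p + 1) = scanSum Q S 1 p := by
  rw [scanSum_succ, scanSum]
  refine Finset.sum_congr rfl fun t ht => ?_
  have hpt : p ∉ t := fun h => by simpa using Finset.mem_powerset.1 ht h
  simp only [interlaces_succ, countBelow_succ, interlaces_insert, countBelow_insert le_rfl, hp,
    hpt, if_false, Finset.mem_insert_self, if_true, add_zero]
  have h0 : ¬ ((Interlaces t S p ∧ countBelow t p + 1 ≤ countBelow S p ∧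
      countBelow S p ≤ countBelow t p + 1 + 1) ∧
      countBelow S p = countBelow t p + 1 + 1) := by
    rintro ⟨⟨h1, -⟩, h2⟩
    have := h1 p le_rfl
    omega
  rw [if_neg h0, add_zero]
  congr 1
  rw [eq_iff_iff]
  constructor
  · rintro ⟨⟨h1, -⟩, h2⟩; exact ⟨h1, h2⟩
  · rintro ⟨h1, h2⟩; exact ⟨⟨h1, by omega⟩, h2⟩

theorem scanSum_zero_succ_of_mem (Q : K) {S : Finset ℕ} {p : ℕ} (hp : p ∈ S) :
    scanSum Q S 0 (p + 1) = scanSum Q S 0 p *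
      (MvPolynomial.X (countBelow S p) ^ p * (MvPolynomial.X (countBelow S p) - 1)) := by
  rw [scanSum_succ, scanSum, Finset.sum_mul]
  refine Finset.sum_congr rfl fun t ht => ?_
  have hpt : p ∉ t := fun h => by simpa using Finset.mem_powerset.1 ht h
  simp only [interlaces_succ, countBelow_succ, interlaces_insert, countBelow_insert le_rfl, hp,
    hpt, if_false, Finset.mem_insert_self, if_true, add_zero, ite_mul, zero_mul, map_one, one_mul]
  have h0 : ¬ ((Interlaces t S p ∧ countBelow t p ≤ countBelow S p + 1 ∧
      countBelow S p + 1 ≤ countBelow t p + 1) ∧ countBelow S p + 1 = countBelow t p) := by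
    rintro ⟨⟨h1, -⟩, h2⟩
    have := h1 p le_rfl
    omega
  rw [if_neg h0, zero_add]
  by_cases h : Interlaces t S p ∧ countBelow S p = countBelow t p
  · rw [if_pos h, if_pos ⟨⟨h.1, by omega⟩, by omega⟩, h.2]
  · rw [if_neg h, if_neg fun h' => h ⟨h'.1.1, by omega⟩]

theorem scanSum_one_succ_of_mem (Q : K) {S : Finset ℕ} {p : ℕ} (hp : p ∈ S) :
    scanSum Q S 1 (p + 1) = scanSum Q S 0 p + scanSum Q S 1 p *
      (MvPolynomial.X (countBelow S p - 1) ^ p * (MvPolynomial.X (countBelow S p - 1) - 1)) := by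
  rw [scanSum_succ, scanSum, scanSum, Finset.sum_mul, ← Finset.sum_add_distrib]
  refine Finset.sum_congr rfl fun t ht => ?_
  have hpt : p ∉ t := fun h => by simpa using Finset.mem_powerset.1 ht h
  simp only [interlaces_succ, countBelow_succ, interlaces_insert, countBelow_insert le_rfl, hp,
    hpt, if_false, Finset.mem_insert_self, if_true, add_zero, ite_mul, zero_mul, map_one, one_mul]
  congr 1
  · congr 1
    rw [eq_iff_iff]
    constructor
    · rintro ⟨⟨h1, -⟩, h2⟩; exact ⟨h1, by omega⟩
    · rintro ⟨h1, h2⟩; exact ⟨⟨h1, by omega⟩, by omega⟩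
  · by_cases h : Interlaces t S p ∧ countBelow S p = countBelow t p + 1
    · rw [if_pos h, if_pos ⟨⟨h.1, by omega⟩, by omega⟩, h.2, Nat.add_sub_cancel]
    · rw [if_neg h, if_neg fun h' => h ⟨h'.1.1, by omega⟩]

/-- The reduced form of `scanSum Q S 1 p`. -/
noncomputable def scanLimit (Q : K) (S : Finset ℕ) (p : ℕ) : MvPolynomial ℕ K :=
  ∑ m ∈ range (countBelow S p), (-1) ^ m * (dropVar K m (markMono K S p) *
    ((∏ i ∈ range m, pairWeight (MvPolynomial.C Q) (MvPolynomial.X i) 1) *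
      ∏ i ∈ Ico m (countBelow S p - 1), pairWeight (MvPolynomial.C Q) 1 (MvPolynomial.X i)))

theorem scanLimit_succ_of_notMem (Q : K) {S : Finset ℕ} {p : ℕ} (hp : p ∉ S) :
    scanLimit Q S (p + 1) = scanLimit Q S p := by
  simp [scanLimit, countBelow_succ, markMono_succ, hp]

theorem dropVar_markMono_of_le {S : Finset ℕ} {p m : ℕ} (h : countBelow S p ≤ m) :
    dropVar K m (markMono K S p) = markMono K S p := by
  rw [markMono, map_prod]
  refine Finset.prod_congr rfl fun i hi => ?_
  split_ifs with hS
  · rw [map_pow, dropVar_X_of_lt ((countBelow_lt (Finset.mem_range.1 hi) hS).trans_le h)]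
  · exact map_one _

theorem scanLimit_succ_of_mem (Q : K) {S : Finset ℕ} {p : ℕ} (hp : p ∈ S) :
    scanLimit Q S (p + 1) = scanLimit Q S p * (MvPolynomial.X (countBelow S p - 1) ^ p *
        pairWeight (MvPolynomial.C Q) 1 (MvPolynomial.X (countBelow S p - 1))) +
      (-1) ^ countBelow S p * (markMono K S p *
        ∏ i ∈ range (countBelow S p), pairWeight (MvPolynomial.C Q) (MvPolynomial.X i) 1) := by
  rw [scanLimit, scanLimit]
  simp only [countBelow_succ, markMono_succ, hp, if_true, Nat.add_sub_cancel]
  rw [Finset.sum_range_succ, Finset.sum_mul]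
  congr 1
  · refine Finset.sum_congr rfl fun m hm => ?_
    have hm := Finset.mem_range.1 hm
    have e : ∏ i ∈ Ico m (countBelow S p), pairWeight (MvPolynomial.C Q) 1
        (MvPolynomial.X i : MvPolynomial ℕ K) =
        (∏ i ∈ Ico m (countBelow S p - 1), pairWeight (MvPolynomial.C Q) 1 (MvPolynomial.X i)) *
        pairWeight (MvPolynomial.C Q) 1 (MvPolynomial.X (countBelow S p - 1)) := by
      rw [← Finset.prod_Ico_succ_top (by omega)]
      congr 2
      omega
    rw [e, map_mul, map_pow, dropVar_X_of_gt hm]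
    ring
  · rw [map_mul, dropVar_markMono_of_le le_rfl, map_pow, dropVar_X_self]
    simp

theorem rename_scanLimit (Q : K) (S : Finset ℕ) (p : ℕ) {σ : ℕ → ℕ}
    (h : ∀ i < countBelow S p - 1, σ i = i) : rename σ (scanLimit Q S p) = scanLimit Q S p := by
  rw [scanLimit, map_sum]
  refine Finset.sum_congr rfl fun m hm => ?_
  have hm := Finset.mem_range.1 hm
  have h1 : rename σ (dropVar K m (markMono K S p)) = dropVar K m (markMono K S p) := by
    rw [markMono, map_prod, map_prod]
    refine Finset.prod_congr rfl fun i hi => ?_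
    split_ifs with hS
    · have hlt := countBelow_lt (Finset.mem_range.1 hi) hS
      rw [map_pow, map_pow]
      congr 1
      rcases lt_trichotomy (countBelow S i) m with h1 | h1 | h1
      · rw [dropVar_X_of_lt h1, MvPolynomial.rename_X, h _ (by omega)]
      · rw [h1, dropVar_X_self, map_one]
      · rw [dropVar_X_of_gt h1, MvPolynomial.rename_X, h _ (by omega)]
    · simp
  have h2 : rename σ (∏ i ∈ range m, pairWeight (MvPolynomial.C Q) (MvPolynomial.X i) 1) =
      ∏ i ∈ range m, pairWeight (MvPolynomial.C Q) (MvPolynomial.X i : MvPolynomial ℕ K) 1 := by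
    rw [map_prod]
    refine Finset.prod_congr rfl fun i hi => ?_
    have hi := Finset.mem_range.1 hi
    rw [map_pairWeight, MvPolynomial.rename_C, MvPolynomial.rename_X, map_one, h i (by omega)]
  have h3 : rename σ (∏ i ∈ Ico m (countBelow S p - 1),
        pairWeight (MvPolynomial.C Q) 1 (MvPolynomial.X i)) =
      ∏ i ∈ Ico m (countBelow S p - 1),
        pairWeight (MvPolynomial.C Q) 1 (MvPolynomial.X i : MvPolynomial ℕ K) := by
    rw [map_prod]
    refine Finset.prod_congr rfl fun i hi => ?_
    rw [map_pairWeight, MvPolynomial.rename_C, MvPolynomial.rename_X, map_one,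
      h i (Finset.mem_Ico.1 hi).2]
  rw [map_mul, map_mul, map_mul, h1, h2, h3, map_pow, map_neg, map_one]

theorem rename_swap_X_of_le {j c : ℕ} (h : j + 1 < c) :
    rename (Equiv.swap j (j + 1)) (MvPolynomial.X c : MvPolynomial ℕ K) = MvPolynomial.X c := by
  rw [MvPolynomial.rename_X, Equiv.swap_apply_of_ne_of_ne (by omega) (by omega)]

theorem scan_invariant (Q : K) (S : Finset ℕ) (p : ℕ) :
    scanSum Q S 1 p - scanLimit Q S p ∈ swapSpan Q (countBelow S p - 1) ∧
    scanSum Q S 0 p - (MvPolynomial.C Q * MvPolynomial.X (countBelow S p - 1) ^ p *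
        scanLimit Q S p + (-1) ^ countBelow S p * (markMono K S p *
          ∏ i ∈ range (countBelow S p), pairWeight (MvPolynomial.C Q) (MvPolynomial.X i) 1)) ∈
      swapSpan Q (countBelow S p) := by
  induction p with
  | zero =>
    simp [scanSum, scanLimit, countBelow_zero, interlaces_zero, scanTerm, diffWeight, markMono]
  | succ p ih =>
    obtain ⟨ih1, ih0⟩ := ih
    set c := countBelow S p with hc
    have hX : ∀ j, j + 1 < c - 1 → rename (Equiv.swap j (j + 1))
        (MvPolynomial.X (c - 1) : MvPolynomial ℕ K) = MvPolynomial.X (c - 1) :=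
      fun j hj => rename_swap_X_of_le hj
    have hmul : ∀ a : K, (scanSum Q S 1 p - scanLimit Q S p) * (MvPolynomial.C a *
        (MvPolynomial.X (c - 1) ^ p * (MvPolynomial.X (c - 1) - 1))) ∈ swapSpan Q c := fun a =>
      swapSpan_mono Q (Nat.sub_le c 1) (mul_mem_swapSpan ih1 fun j hj => by
        simp only [map_mul, map_sub, map_pow, map_one, MvPolynomial.rename_C, hX j hj])
    by_cases hp : p ∈ S
    · have hc1 : countBelow S (p + 1) = c + 1 := by simp [countBelow_succ, hp, hc]
      rw [scanSum_one_succ_of_mem Q hp, scanSum_zero_succ_of_mem Q hp, scanLimit_succ_of_mem Q hp,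
        hc1, ← hc, Nat.add_sub_cancel]
      constructor
      · have h1 := hmul 1
        rw [map_one, one_mul] at h1
        convert Submodule.add_mem _ ih0 h1 using 1
        simp only [pairWeight]
        ring
      · have h2 : (scanSum Q S 0 p - (MvPolynomial.C Q * MvPolynomial.X (c - 1) ^ p *
            scanLimit Q S p + (-1) ^ c * (markMono K S p *
            ∏ i ∈ range c, pairWeight (MvPolynomial.C Q) (MvPolynomial.X i) 1))) *
            (MvPolynomial.X c ^ p * (MvPolynomial.X c - 1)) ∈ swapSpan Q (c + 1) :=
          swapSpan_mono Q (Nat.le_succ c) (mul_mem_swapSpan ih0 fun j hj => by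
            simp only [map_mul, map_sub, map_pow, map_one, rename_swap_X_of_le hj])
        have h3 : MvPolynomial.C Q * (MvPolynomial.X c * MvPolynomial.X (c - 1)) ^ p *
            scanLimit Q S p * pairWeight (MvPolynomial.C Q) (MvPolynomial.X c)
              (MvPolynomial.X (c - 1)) ∈ swapSpan Q (c + 1) := by
          rcases Nat.eq_zero_or_pos c with h | h
          · rw [scanLimit, ← hc, h]; simp
          · obtain ⟨b, hb⟩ : ∃ b, c = b + 1 := ⟨c - 1, by omega⟩
            rw [hb]
            refine Submodule.subset_span ⟨b, _, by omega, ?_, rfl⟩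
            simp only [map_mul, map_pow, MvPolynomial.rename_C, MvPolynomial.rename_X,
              Nat.add_sub_cancel, Equiv.swap_apply_left, Equiv.swap_apply_right]
            rw [rename_scanLimit Q S p fun i hi =>
              Equiv.swap_apply_of_ne_of_ne (by omega) (by omega)]
            ring
        convert Submodule.sub_mem _ h2 h3 using 1
        simp only [markMono_succ, hp, if_true, Finset.prod_range_succ _ c, ← hc]
        simp only [pairWeight]
        ring
    · have hc1 : countBelow S (p + 1) = c := by simp [countBelow_succ, hp, hc]
      rw [scanSum_one_succ_of_notMem Q hp, scanSum_zero_succ_of_notMem Q hp,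
        scanLimit_succ_of_notMem Q hp, hc1, ← hc]
      refine ⟨ih1, ?_⟩
      convert Submodule.add_mem _ ih0 (hmul Q) using 1
      simp only [markMono_succ, hp, if_false]
      ring

theorem sum_interlaces_binomDet [IsDomain K] [CharZero K] (Q : K) (S : Finset ℕ) {N n : ℕ}
    (hn : countBelow S N = n + 1) :
    (∑ t ∈ (range N).powerset, if Interlaces t S N ∧ countBelow t N = n then
      diffWeight Q S t N * binomDet K n 0 (markMono K t N * pairProd Q n) else 0) =
    binomDet K (n + 1) 0 (markMono K S N * pairProd Q (n + 1)) := by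
  have h1 : (∑ t ∈ (range N).powerset, if Interlaces t S N ∧ countBelow t N = n then
      diffWeight Q S t N * binomDet K n 0 (markMono K t N * pairProd Q n) else 0) =
      binomDet K n 1 (scanSum Q S 1 N * pairProd Q n) := by
    rw [scanSum, Finset.sum_mul, map_sum]
    refine Finset.sum_congr rfl fun t _ => ?_
    by_cases h : Interlaces t S N ∧ countBelow t N = n
    · rw [if_pos h, if_pos ⟨h.1, by rw [hn, h.2]⟩, ← binomDet_prod_X_sub_one_mul, ← smul_eq_mul,
        ← map_smul, scanTerm, h.2, MvPolynomial.smul_eq_C_mul]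
      congr 1
      ring
    · rw [if_neg h, if_neg (fun h' => h ⟨h'.1, by omega⟩), zero_mul, map_zero]
  have h2 := binomDet_mul_pairProd_eq_zero 1 (show scanSum Q S 1 N - scanLimit Q S N ∈
    swapSpan Q n by simpa [hn] using (scan_invariant Q S N).1)
  rw [sub_mul, map_sub, sub_eq_zero] at h2
  rw [h1]
  refine h2.trans ?_
  rw [binomDet_succ_eq_sum_dropVar, scanLimit, hn, Finset.sum_mul, map_sum]
  refine Finset.sum_congr rfl fun m hm => ?_
  rw [map_mul (dropVar K m),
    dropVar_pairProd_succ Q (Nat.lt_succ_iff.1 (Finset.mem_range.1 hm)), Nat.add_sub_cancel,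
    ← smul_eq_mul ((-1 : K) ^ m), ← map_smul, MvPolynomial.smul_eq_C_mul, map_pow, map_neg,
    map_one]
  congr 1
  ring

end Scan

section Chains

variable {K : Type*} [CommRing K]

/-- The sum over all paths of length `m` from `a` to `s` of the product of the weights of their
steps, by recursion on the last step. -/
def pathSum {α : Type*} [Fintype α] [DecidableEq α] (W : ℕ → α → α → K) (a : α) : ℕ → α → K
  | 0, s => if s = a then 1 else 0
  | m + 1, s => ∑ t, W m t s * pathSum W a m t

theorem pathSum_eq_sum {α : Type*} [Fintype α] [DecidableEq α] (W : ℕ → α → α → K) (a : α)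
    (m : ℕ) (s : α) : pathSum W a m s = ∑ c : Fin (m + 1) → α,
      if c 0 = a ∧ c (Fin.last m) = s then ∏ i : Fin m, W i (c i.castSucc) (c i.succ) else 0 := by
  induction m generalizing s with
  | zero =>
    rw [← (Equiv.funUnique (Fin 1) α).symm.sum_comp]
    simp only [pathSum, Fin.prod_univ_zero]
    rw [Finset.sum_eq_single s]
    · simp
    · intro b _ hb
      rw [if_neg]
      rintro ⟨-, h⟩
      exact hb h
    · simp
  | succ m ih =>
    rw [← (Fin.snocEquiv fun _ : Fin (m + 2) => α).sum_comp, Fintype.sum_prod_type_right]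
    simp only [pathSum, ih, Finset.mul_sum]
    rw [Finset.sum_comm]
    refine Finset.sum_congr rfl fun c _ => ?_
    rw [Finset.sum_eq_single (c (Fin.last m)), Finset.sum_eq_single s]
    · have h0 : (Fin.snocEquiv fun _ : Fin (m + 2) => α) (s, c) 0 = c 0 :=
        Fin.snoc_castSucc (α := fun _ => α) s c 0
      have h1 (i : Fin m) :
          (Fin.snocEquiv fun _ : Fin (m + 2) => α) (s, c) i.castSucc.succ = c i.succ :=
        Fin.snoc_castSucc (α := fun _ => α) s c i.succ
      have h2 (i : Fin (m + 1)) :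
          (Fin.snocEquiv fun _ : Fin (m + 2) => α) (s, c) i.castSucc = c i :=
        Fin.snoc_castSucc (α := fun _ => α) s c i
      have h3 : (Fin.snocEquiv fun _ : Fin (m + 2) => α) (s, c) (Fin.last (m + 1)) = s :=
        Fin.snoc_last (α := fun _ => α) s c
      rw [Fin.prod_univ_castSucc]
      simp only [h0, h1, h2, h3, Fin.succ_last, and_true, Fin.val_castSucc, Fin.val_last]
      split_ifs <;> ring
    · intro b _ hb
      rw [if_neg]
      rintro ⟨-, h⟩
      refine hb ?_
      rw [← h]
      exact (Fin.snoc_last (α := fun _ => α) b c).symm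
    · simp
    · intro b _ hb
      rw [if_neg (fun h => hb h.2.symm), mul_zero]
    · simp

/-- The weight of the column of an alternating sign matrix of order `N` that turns the set `t` of
rows with partial sum `1` into `S`, where the column has index `m`. -/
def columnWeight (Q : K) (N m : ℕ) (t S : Finset ℕ) : K :=
  if Interlaces t S N ∧ countBelow t N = m then diffWeight Q S t N else 0

theorem eq_empty_of_countBelow_eq_zero {S : Finset ℕ} {N : ℕ} (hS : S ⊆ range N)
    (h : countBelow S N = 0) : S = ∅ := by
  refine Finset.eq_empty_of_forall_notMem fun i hi => ?_
  have := countBelow_lt (Finset.mem_range.1 (hS hi)) hi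
  omega

theorem pathSum_columnWeight [IsDomain K] [CharZero K] (Q : K) (N m : ℕ)
    (S : (range N).powerset) (hm : countBelow S N = m) :
    pathSum (fun m (t S : (range N).powerset) => columnWeight Q N m t S)
      ⟨∅, Finset.empty_mem_powerset _⟩ m S =
    binomDet K m 0 (markMono K S N * pairProd Q m) := by
  induction m generalizing S with
  | zero =>
    have hS := eq_empty_of_countBelow_eq_zero (Finset.mem_powerset.1 S.2) hm
    rw [pathSum, if_pos (Subtype.ext hS), hS]
    have : markMono K ∅ N * pairProd Q 0 = MvPolynomial.monomial 0 1 := by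
      simp [markMono, pairProd]
    rw [this, binomDet_monomial]
    simp
  | succ m ih =>
    rw [← sum_interlaces_binomDet Q S hm, ← Finset.sum_coe_sort, pathSum]
    refine Finset.sum_congr rfl fun t _ => ?_
    rw [columnWeight]
    split_ifs with h
    · rw [ih t h.2]
    · rw [zero_mul]

/-- The odd numbers below `N`. -/
def oddBelow (N : ℕ) : Finset ℕ := {i ∈ range N | Odd i}

theorem countBelow_oddBelow {N p : ℕ} (hp : p ≤ N) : countBelow (oddBelow N) p = p / 2 := by
  induction p with
  | zero => rfl
  | succ p ih =>
    rw [countBelow_succ, ih (by omega)]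
    have : p ∈ oddBelow N ↔ p % 2 = 1 := by
      simp [oddBelow, Nat.odd_iff, show p < N by omega]
    rw [if_congr this rfl rfl]
    split_ifs <;> omega

theorem markMono_oddBelow (N n : ℕ) (h : 2 * n + 1 ≤ N) : markMono K (oddBelow N) (2 * n + 1) =
    ∏ i ∈ range n, MvPolynomial.X i ^ (2 * i + 1) := by
  induction n with
  | zero => simp [markMono, oddBelow]
  | succ n ih =>
    rw [mul_add, mul_one, markMono_succ, markMono_succ, ih (by omega), Finset.prod_range_succ,
      if_pos, if_neg, countBelow_oddBelow (by omega), mul_one]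
    · congr 3; omega
    · simp [oddBelow, Nat.odd_iff]
    · simp [oddBelow, Nat.odd_iff]
      omega

theorem pathSum_columnWeight_oddBelow (n : ℕ) (hn : 1 ≤ n) :
    pathSum (fun m (t S : (range (2 * n + 1)).powerset) =>
        columnWeight (X ^ 2 : ℤ[X]) (2 * n + 1) m t S)
      ⟨∅, Finset.empty_mem_powerset _⟩ n
      ⟨oddBelow (2 * n + 1), Finset.mem_powerset.2 (Finset.filter_subset _ _)⟩ =
    Tpoly (2 * n) ((n : ℤ) - 1) 2 := by
  rw [pathSum_columnWeight, markMono_oddBelow _ _ le_rfl,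
    binomDet_odd (pow_ne_zero 2 Polynomial.X_ne_zero)]
  · obtain ⟨N, rfl⟩ : ∃ N, n = N + 1 := ⟨n - 1, by omega⟩
    rw [det_rPoly_eq_Tpoly]
    push_cast
    rw [add_sub_cancel_right]
  · rw [countBelow_oddBelow le_rfl]
    omega

end Chains

section Bijection

theorem Fin.sum_Iic_eq_sum_range {M : Type*} [AddCommMonoid M] {N : ℕ} (f : ℕ → M) (j : Fin N) :
    ∑ k ∈ Iic j, f k = ∑ k ∈ range (j + 1), f k := by
  rw [Nat.range_succ_eq_Iic, ← Fin.map_valEmbedding_Iic, Finset.sum_map]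
  rfl

/-- The partial sum of the first `j` entries of row `i` of the vertically symmetric matrix encoded
by `c`. -/
def stateSum (n : ℕ) (c : ℕ → Finset ℕ) (j i : ℕ) : ℤ :=
  if j ≤ n then if i ∈ c j then 1 else 0 else if i ∈ c (2 * n + 1 - j) then 0 else 1

/-- The vertically symmetric matrix of order `2n+1` such that, for `j ≤ n`, the rows in which the
first `j` entries sum to `1` are those in `c j`. -/
def chainMatrix (n : ℕ) (c : ℕ → Finset ℕ) : Matrix (Fin (2 * n + 1)) (Fin (2 * n + 1)) ℤ :=
  Matrix.of fun i j => stateSum n c (j + 1) i - stateSum n c j i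

/-- The conditions on `c` for `chainMatrix n c` to be an alternating sign matrix. -/
structure IsStateChain (n : ℕ) (c : ℕ → Finset ℕ) : Prop where
  zero : c 0 = ∅
  last : c n = oddBelow (2 * n + 1)
  interlaces : ∀ j < n, Interlaces (c j) (c (j + 1)) (2 * n + 1)
  countBelow_eq : ∀ j < n, countBelow (c j) (2 * n + 1) = j

variable {n : ℕ} {c : ℕ → Finset ℕ}

theorem stateSum_eq_zero_or_one (n : ℕ) (c : ℕ → Finset ℕ) (j i : ℕ) :
    stateSum n c j i = 0 ∨ stateSum n c j i = 1 := by
  unfold stateSum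
  split_ifs <;> simp

theorem stateSum_reflect {j : ℕ} (hj : j ≤ 2 * n + 1) (i : ℕ) :
    stateSum n c (2 * n + 1 - j) i = 1 - stateSum n c j i := by
  unfold stateSum
  rw [Nat.sub_sub_self hj]
  by_cases h : j ≤ n
  · rw [if_neg (by omega), if_pos h]
    split_ifs <;> simp
  · rw [if_pos (by omega), if_neg h]
    split_ifs <;> simp

theorem stateSum_sub_reflect {j : ℕ} (hj : j < 2 * n + 1) (i : ℕ) :
    stateSum n c (2 * n - j + 1) i - stateSum n c (2 * n - j) i =
      stateSum n c (j + 1) i - stateSum n c j i := by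
  have h1 := stateSum_reflect (c := c) hj.le i
  have h2 := stateSum_reflect (c := c) (Nat.succ_le_of_lt hj) i
  rw [show 2 * n + 1 - j = 2 * n - j + 1 by omega] at h1
  rw [show 2 * n + 1 - j.succ = 2 * n - j by omega] at h2
  rw [h1, h2]
  ring

theorem isVSym_chainMatrix (n : ℕ) (c : ℕ → Finset ℕ) : IsVSym (chainMatrix n c) := by
  intro i j
  have h := stateSum_sub_reflect (c := c) j.2 i
  have e : (j.rev : ℕ) = 2 * n - j := by rw [Fin.val_rev]; omega
  simp only [chainMatrix, Matrix.of_apply, e, h]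

theorem sum_stateSum_of_le {j : ℕ} (hj : j ≤ n) (p : ℕ) :
    ∑ i ∈ range p, stateSum n c j i = countBelow (c j) p := by
  simp only [stateSum, if_pos hj, countBelow, Finset.sum_boole]

theorem IsStateChain.countBelow_succ_eq (hc : IsStateChain n c) {j : ℕ} (hj : j < n) :
    countBelow (c (j + 1)) (2 * n + 1) = j + 1 := by
  rcases (Nat.succ_le_of_lt hj).lt_or_eq with h | h
  · exact hc.countBelow_eq _ h
  · rw [Nat.succ_eq_add_one] at h
    rw [h, hc.last, countBelow_oddBelow le_rfl]
    omega

theorem IsStateChain.sum_column (hc : IsStateChain n c) {j : ℕ} (hj : j ≤ n) {p : ℕ}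
    (hp : p ≤ 2 * n + 1) :
    (∑ i ∈ range p, (stateSum n c (j + 1) i - stateSum n c j i) = 0 ∨
      ∑ i ∈ range p, (stateSum n c (j + 1) i - stateSum n c j i) = 1) ∧
    (p = 2 * n + 1 → ∑ i ∈ range p, (stateSum n c (j + 1) i - stateSum n c j i) = 1) := by
  rcases hj.lt_or_eq with hj | rfl
  · rw [Finset.sum_sub_distrib, sum_stateSum_of_le (j := j + 1) hj, sum_stateSum_of_le hj.le]
    have h1 := hc.interlaces j hj p hp
    refine ⟨by omega, ?_⟩
    rintro rfl
    rw [hc.countBelow_eq j hj, hc.countBelow_succ_eq hj]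
    push_cast
    ring
  · have h (i : ℕ) : stateSum j c (j + 1) i - stateSum j c j i = 1 - 2 * stateSum j c j i := by
      have := stateSum_reflect (n := j) (c := c) (show j ≤ 2 * j + 1 by omega) i
      rw [show 2 * j + 1 - j = j + 1 by omega] at this
      rw [this]
      ring
    simp only [h]
    rw [Finset.sum_sub_distrib, ← Finset.mul_sum, sum_stateSum_of_le le_rfl, hc.last,
      countBelow_oddBelow hp]
    simp only [Finset.sum_const, Finset.card_range, nsmul_eq_mul, mul_one]
    omega

theorem IsStateChain.isASM_chainMatrix (hc : IsStateChain n c) : IsASM (chainMatrix n c) := by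
  have hzero (i : ℕ) : stateSum n c 0 i = 0 := by simp [stateSum, hc.zero]
  have hrow (i : Fin (2 * n + 1)) (p : ℕ) :
      ∑ k ∈ range p, (stateSum n c (k + 1) i - stateSum n c k i) = stateSum n c p i := by
    rw [Finset.sum_range_sub (fun k => stateSum n c k i), hzero, sub_zero]
  have hcol (j : Fin (2 * n + 1)) {p : ℕ} (hp : p ≤ 2 * n + 1) :
      (∑ i ∈ range p, (stateSum n c (j + 1) i - stateSum n c j i) = 0 ∨
        ∑ i ∈ range p, (stateSum n c (j + 1) i - stateSum n c j i) = 1) ∧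
      (p = 2 * n + 1 → ∑ i ∈ range p, (stateSum n c (j + 1) i - stateSum n c j i) = 1) := by
    rcases le_or_gt (j : ℕ) n with h | h
    · exact hc.sum_column h hp
    · simp only [← stateSum_sub_reflect (c := c) j.2]
      exact hc.sum_column (by omega) hp
  refine ⟨fun i j => ?_, fun i => ?_, fun j => ?_, fun i j => ?_, fun i j => ?_⟩
  · rw [chainMatrix, Matrix.of_apply]
    rcases stateSum_eq_zero_or_one n c (j + 1) i with h1 | h1 <;>
    rcases stateSum_eq_zero_or_one n c j i with h2 | h2 <;> simp [h1, h2]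
  · simp only [chainMatrix, Matrix.of_apply]
    rw [Fin.sum_univ_eq_sum_range (fun k => stateSum n c (k + 1) i - stateSum n c k i), hrow]
    have h := stateSum_reflect (n := n) (c := c) (Nat.zero_le _) i
    rwa [Nat.sub_zero, hzero, sub_zero] at h
  · simp only [chainMatrix, Matrix.of_apply]
    rw [Fin.sum_univ_eq_sum_range (fun k => stateSum n c (j + 1) k - stateSum n c j k)]
    exact (hcol j le_rfl).2 rfl
  · simp only [chainMatrix, Matrix.of_apply]
    rw [Fin.sum_Iic_eq_sum_range (fun k => stateSum n c (k + 1) i - stateSum n c k i), hrow]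
    exact stateSum_eq_zero_or_one _ _ _ _
  · simp only [chainMatrix, Matrix.of_apply]
    rw [Fin.sum_Iic_eq_sum_range (fun k => stateSum n c (j + 1) k - stateSum n c j k)]
    exact (hcol j i.2).1

theorem chainMatrix_congr {c d : ℕ → Finset ℕ} (h : ∀ j ≤ n, c j = d j) :
    chainMatrix n c = chainMatrix n d := by
  have (j i : ℕ) (hj : j ≤ 2 * n + 1) : stateSum n c j i = stateSum n d j i := by
    unfold stateSum
    by_cases hjn : j ≤ n
    · rw [if_pos hjn, if_pos hjn, h j hjn]
    · rw [if_neg hjn, if_neg hjn, h _ (by omega)]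
  ext i j
  simp only [chainMatrix, Matrix.of_apply]
  rw [this _ _ j.2, this _ _ j.2.le]

theorem IsStateChain.congr {c d : ℕ → Finset ℕ} (hc : IsStateChain n c)
    (h : ∀ j ≤ n, c j = d j) : IsStateChain n d where
  zero := by rw [← h 0 (Nat.zero_le n), hc.zero]
  last := by rw [← h n le_rfl, hc.last]
  interlaces j hj := by rw [← h j hj.le, ← h (j + 1) hj]; exact hc.interlaces j hj
  countBelow_eq j hj := by rw [← h j hj.le]; exact hc.countBelow_eq j hj

theorem IsStateChain.eq_of_chainMatrix_eq {c d : ℕ → Finset ℕ} (hc : IsStateChain n c)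
    (hd : IsStateChain n d) (h : chainMatrix n c = chainMatrix n d) {i j : ℕ}
    (hi : i < 2 * n + 1) (hj : j ≤ n) : i ∈ c j ↔ i ∈ d j := by
  have key : ∀ j ≤ n, stateSum n c j i = stateSum n d j i := by
    intro j hj
    induction j with
    | zero => simp [stateSum, hc.zero, hd.zero]
    | succ j ih =>
      have h1 := congrFun (congrFun h ⟨i, hi⟩) ⟨j, by omega⟩
      simp only [chainMatrix, Matrix.of_apply] at h1
      have := ih (by omega)
      omega
  have := key j hj
  simp only [stateSum, if_pos hj] at this
  by_cases h1 : i ∈ c j <;> by_cases h2 : i ∈ d j <;> simp_all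

theorem exists_isStateChain {A : Matrix (Fin (2 * n + 1)) (Fin (2 * n + 1)) ℤ} (hA : IsASM A)
    (hV : IsVSym A) : ∃ c : ℕ → Finset ℕ, IsStateChain n c ∧ (∀ j, c j ⊆ range (2 * n + 1)) ∧
      chainMatrix n c = A := by
  obtain ⟨-, hrow, hcol, hrows, hcols⟩ := hA
  set B : ℕ → ℕ → ℤ := fun i j =>
    if h : i < 2 * n + 1 ∧ j < 2 * n + 1 then A ⟨i, h.1⟩ ⟨j, h.2⟩ else 0 with hB
  have hAB (i j : Fin (2 * n + 1)) : A i j = B i j := by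
    simp only [hB]
    rw [dif_pos (And.intro i.2 j.2)]
  set R : ℕ → ℕ → ℤ := fun j i => ∑ k ∈ range j, B i k with hR
  have hR0 (i : ℕ) : R 0 i = 0 := by simp [hR]
  have hRs (j i : ℕ) : R (j + 1) i = R j i + B i j := Finset.sum_range_succ _ _
  have hRN {i : ℕ} (hi : i < 2 * n + 1) : R (2 * n + 1) i = 1 := by
    rw [← hrow ⟨i, hi⟩, Finset.sum_congr rfl fun j _ => hAB ⟨i, hi⟩ j,
      Fin.sum_univ_eq_sum_range (fun k => B i k)]
  have hR01 {i j : ℕ} (hi : i < 2 * n + 1) (hj : j ≤ 2 * n + 1) : R j i = 0 ∨ R j i = 1 := by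
    cases j with
    | zero => exact Or.inl (hR0 i)
    | succ j =>
      have := hrows ⟨i, hi⟩ ⟨j, hj⟩
      rw [Finset.sum_congr rfl fun j _ => hAB ⟨i, hi⟩ j,
        Fin.sum_Iic_eq_sum_range (fun k => B i k)] at this
      exact this
  have hBs {i j : ℕ} (hi : i < 2 * n + 1) (hj : j < 2 * n + 1) : B i (2 * n - j) = B i j := by
    have h := hV ⟨i, hi⟩ ⟨j, hj⟩
    rw [hAB, hAB, Fin.val_rev] at h
    rw [h]
    congr 1
    simp only
    omega
  have hRr {i : ℕ} (hi : i < 2 * n + 1) {j : ℕ} (hj : j ≤ 2 * n + 1) :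
      R (2 * n + 1 - j) i = 1 - R j i := by
    induction j with
    | zero => rw [hR0, Nat.sub_zero, hRN hi, sub_zero]
    | succ j ih =>
      have h1 := ih (by omega)
      rw [show 2 * n + 1 - j = 2 * n - j + 1 by omega, hRs, hBs hi (by omega)] at h1
      rw [show 2 * n + 1 - (j + 1) = 2 * n - j by omega, hRs]
      linarith
  have hC01 {j p : ℕ} (hj : j < 2 * n + 1) (hp : p ≤ 2 * n + 1) :
      ∑ i ∈ range p, B i j = 0 ∨ ∑ i ∈ range p, B i j = 1 := by
    cases p with
    | zero => simp
    | succ p =>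
      have := hcols ⟨p, hp⟩ ⟨j, hj⟩
      rw [Finset.sum_congr rfl fun i _ => hAB i ⟨j, hj⟩,
        Fin.sum_Iic_eq_sum_range (fun k => B k j)] at this
      exact this
  have hCN {j : ℕ} (hj : j < 2 * n + 1) : ∑ i ∈ range (2 * n + 1), B i j = 1 := by
    rw [← hcol ⟨j, hj⟩, Finset.sum_congr rfl fun i _ => hAB i ⟨j, hj⟩,
      Fin.sum_univ_eq_sum_range (fun k => B k j)]
  set c : ℕ → Finset ℕ := fun j => {i ∈ range (2 * n + 1) | R j i = 1} with hc
  have hRc {i j : ℕ} (hi : i < 2 * n + 1) (hj : j ≤ 2 * n + 1) :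
      R j i = if i ∈ c j then 1 else 0 := by
    have h := hR01 hi hj
    split_ifs with h1
    · exact (Finset.mem_filter.1 h1).2
    · exact h.resolve_right fun h2 => h1 (Finset.mem_filter.2 ⟨Finset.mem_range.2 hi, h2⟩)
  have hsum {j p : ℕ} (hj : j ≤ 2 * n + 1) (hp : p ≤ 2 * n + 1) :
      ∑ i ∈ range p, R j i = countBelow (c j) p := by
    rw [countBelow, ← Finset.sum_boole]
    exact Finset.sum_congr rfl fun i hi =>
      hRc (by have := Finset.mem_range.1 hi; omega) hj
  have hcolumn {j p : ℕ} (hj : j < 2 * n + 1) (hp : p ≤ 2 * n + 1) :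
      (countBelow (c (j + 1)) p : ℤ) = countBelow (c j) p + ∑ i ∈ range p, B i j := by
    rw [← hsum hj hp, ← hsum hj.le hp, ← Finset.sum_add_distrib]
    simp only [hRs]
  have hstate {i j : ℕ} (hi : i < 2 * n + 1) (hj : j ≤ 2 * n + 1) : stateSum n c j i = R j i := by
    unfold stateSum
    split_ifs with h1 h2 h2
    · rw [hRc hi hj, if_pos h2]
    · rw [hRc hi hj, if_neg h2]
    · have := hRr hi hj
      rw [hRc hi (by omega), if_pos h2] at this
      linarith
    · have := hRr hi hj
      rw [hRc hi (by omega), if_neg h2] at this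
      linarith
  have hczero : c 0 = ∅ := by simp [hc, hR0]
  refine ⟨c, ⟨hczero, ?_, fun j hj p hp => ?_, fun j hj => ?_⟩,
    fun j => Finset.filter_subset _ _, ?_⟩
  · have hmid {p : ℕ} (hp : p ≤ 2 * n + 1) : countBelow (c n) p = p / 2 := by
      have h1 := hC01 (show n < 2 * n + 1 by omega) hp
      have h2 : ∑ i ∈ range p, B i n = p - 2 * countBelow (c n) p := by
        rw [← hsum (by omega) hp, Finset.mul_sum]
        have : (p : ℤ) = ∑ i ∈ range p, 1 := by simp
        rw [this, ← Finset.sum_sub_distrib]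
        refine Finset.sum_congr rfl fun i hi => ?_
        have h3 := hRr (i := i) (by have := Finset.mem_range.1 hi; omega)
          (show n ≤ 2 * n + 1 by omega)
        rw [show 2 * n + 1 - n = n + 1 by omega, hRs] at h3
        linarith
      omega
    ext i
    by_cases hi : i < 2 * n + 1
    · have h1 := hmid hi.le
      have h2 := hmid (Nat.succ_le_of_lt hi)
      rw [Nat.succ_eq_add_one, countBelow_succ, h1] at h2
      simp only [oddBelow, Finset.mem_filter, Finset.mem_range, hi, true_and, Nat.odd_iff]
      split_ifs at h2 with h
      · simp only [h, true_iff]; omega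
      · simp only [h, false_iff]; omega
    · simp [hc, oddBelow, hi]
  · have h1 := hcolumn (show j < 2 * n + 1 by omega) hp
    have h2 := hC01 (show j < 2 * n + 1 by omega) hp
    omega
  · induction j with
    | zero => simp [hczero, countBelow]
    | succ j ih =>
      have h1 := hcolumn (show j < 2 * n + 1 by omega) le_rfl
      rw [hCN (by omega), ih (by omega)] at h1
      exact_mod_cast h1
  · ext i j
    rw [chainMatrix, Matrix.of_apply, hstate i.2 j.2, hstate i.2 j.2.le, hRs, hAB]
    ring

theorem chainMatrix_eq_neg_one_iff (c : ℕ → Finset ℕ) (i j : Fin (2 * n + 1)) (hj : (j : ℕ) < n) :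
    chainMatrix n c i j = -1 ↔ (i : ℕ) ∈ c j ∧ (i : ℕ) ∉ c (j + 1) := by
  rw [chainMatrix, Matrix.of_apply, stateSum, stateSum, if_pos (Nat.succ_le_of_lt hj),
    if_pos hj.le]
  split_ifs with h1 h2 h2 <;> simp [h1, h2]

theorem pow_numNegLeft_chainMatrix {K : Type*} [CommRing K] (Q : K) (c : ℕ → Finset ℕ) :
    Q ^ numNegLeft n (chainMatrix n c) =
      ∏ j ∈ range n, diffWeight Q (c (j + 1)) (c j) (2 * n + 1) := by
  rw [numNegLeft, ← Finset.prod_const, Finset.prod_filter, Fintype.prod_prod_type_right]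
  have h (j : Fin (2 * n + 1)) : (∏ i : Fin (2 * n + 1),
      if chainMatrix n c i j = -1 ∧ (j : ℕ) < n then Q else 1) =
      if (j : ℕ) < n then diffWeight Q (c (j + 1)) (c j) (2 * n + 1) else 1 := by
    by_cases hj : (j : ℕ) < n
    · rw [if_pos hj, diffWeight, ← Fin.prod_univ_eq_prod_range
        (fun i => if i ∈ c j ∧ i ∉ c (j + 1) then Q else 1)]
      exact Finset.prod_congr rfl fun i _ =>
        if_congr (by rw [chainMatrix_eq_neg_one_iff c i j hj, and_iff_left hj]) rfl rfl
    · rw [if_neg hj]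
      exact Finset.prod_eq_one fun i _ => if_neg fun h => hj h.2
  rw [Finset.prod_congr rfl fun j _ => h j, Fin.prod_univ_eq_prod_range
    (fun j => if j < n then diffWeight Q (c (j + 1)) (c j) (2 * n + 1) else 1),
    ← Finset.prod_filter]
  congr 1
  ext j
  simp only [Finset.mem_filter, Finset.mem_range]
  omega

/-- The extension of a finite sequence of sets to all natural numbers. -/
def chainExtend {N : ℕ} (c : Fin (n + 1) → (range N).powerset) (j : ℕ) : Finset ℕ :=
  c (Fin.ofNat (n + 1) j)

theorem chainExtend_of_le {N : ℕ} (c : Fin (n + 1) → (range N).powerset) {j : ℕ} (hj : j ≤ n) :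
    chainExtend c j = c ⟨j, Nat.lt_succ_of_le hj⟩ := by
  rw [chainExtend]
  congr 2
  exact Fin.ext (Nat.mod_eq_of_lt (Nat.lt_succ_of_le hj))

theorem bijOn_chainMatrix (n : ℕ) : Set.BijOn
    (fun c : Fin (n + 1) → (range (2 * n + 1)).powerset => chainMatrix n (chainExtend c))
    {c | IsStateChain n (chainExtend c)} {A | IsASM A ∧ IsVSym A} := by
  refine ⟨fun c hc => ⟨hc.isASM_chainMatrix, isVSym_chainMatrix _ _⟩, fun c hc d hd h => ?_,
    fun A hA => ?_⟩
  · ext j i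
    have h1 : ∀ c : Fin (n + 1) → (range (2 * n + 1)).powerset, i ∈ (c j : Finset ℕ) →
        i < 2 * n + 1 := fun c hi => Finset.mem_range.1 (Finset.mem_powerset.1 (c j).2 hi)
    by_cases hi : i < 2 * n + 1
    · have := IsStateChain.eq_of_chainMatrix_eq hc hd h hi (Nat.lt_succ_iff.1 j.2)
      rwa [chainExtend_of_le c (Nat.lt_succ_iff.1 j.2),
        chainExtend_of_le d (Nat.lt_succ_iff.1 j.2)] at this
    · exact ⟨fun h => (hi (h1 c h)).elim, fun h => (hi (h1 d h)).elim⟩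
  · obtain ⟨c, hc, hsub, rfl⟩ := exists_isStateChain hA.1 hA.2
    set d : Fin (n + 1) → (range (2 * n + 1)).powerset :=
      fun j => ⟨c j, Finset.mem_powerset.2 (hsub j)⟩ with hd
    have h (j : ℕ) (hj : j ≤ n) : c j = chainExtend d j := by rw [chainExtend_of_le d hj]
    exact ⟨d, hc.congr h, (chainMatrix_congr h).symm⟩

theorem ite_prod_columnWeight {K : Type*} [CommRing K] (Q : K)
    (c : Fin (n + 1) → (range (2 * n + 1)).powerset) [Decidable (IsStateChain n (chainExtend c))] :
    (if c 0 = ⟨∅, Finset.empty_mem_powerset _⟩ ∧ c (Fin.last n) =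
        ⟨oddBelow (2 * n + 1), Finset.mem_powerset.2 (Finset.filter_subset _ _)⟩ then
      ∏ j : Fin n, columnWeight Q (2 * n + 1) j (c j.castSucc) (c j.succ) else 0) =
    if IsStateChain n (chainExtend c) then Q ^ numNegLeft n (chainMatrix n (chainExtend c))
      else 0 := by
  have h1 (j : Fin n) : (c j.castSucc : Finset ℕ) = chainExtend c j :=
    (chainExtend_of_le c j.2.le).symm
  have h2 (j : Fin n) : (c j.succ : Finset ℕ) = chainExtend c (j + 1) :=
    (chainExtend_of_le c j.2).symm
  have h3 : (c 0 : Finset ℕ) = chainExtend c 0 := (chainExtend_of_le c (Nat.zero_le n)).symm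
  have h4 : (c (Fin.last n) : Finset ℕ) = chainExtend c n := (chainExtend_of_le c le_rfl).symm
  simp only [Subtype.ext_iff, h1, h2, h3, h4]
  rw [Fin.prod_univ_eq_prod_range (fun j => columnWeight Q (2 * n + 1) j (chainExtend c j)
    (chainExtend c (j + 1))), pow_numNegLeft_chainMatrix]
  by_cases h : IsStateChain n (chainExtend c)
  · rw [if_pos ⟨h.zero, h.last⟩, if_pos h]
    refine Finset.prod_congr rfl fun j hj => ?_
    have hj := Finset.mem_range.1 hj
    rw [columnWeight, if_pos ⟨h.interlaces j hj, h.countBelow_eq j hj⟩]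
  · rw [if_neg h]
    split_ifs with h0
    · by_contra hne
      refine h ⟨h0.1, h0.2, ?_, ?_⟩ <;>
      · intro j hj
        by_contra hj'
        refine hne (Finset.prod_eq_zero (Finset.mem_range.2 hj) (if_neg ?_))
        tauto
    · rfl

end Bijection

/-- The `τ²`-enumeration of vertically symmetric alternating sign matrices of order `2n+1`,
    weighted by `τ^{2ν(A)}` where `ν(A)` counts the `-1` entries strictly left of the middle
    column, equals `T(2n, n-1, 2)`. -/
theorem vsasm_tau_squared_enumeration (n : ℕ) (hn : 1 ≤ n) :
    (∑ᶠ (A : Matrix (Fin (2 * n + 1)) (Fin (2 * n + 1)) ℤ) (_ : IsASM A ∧ IsVSym A),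
        (Polynomial.X : Polynomial ℤ) ^ (2 * numNegLeft n A)) =
      Tpoly (2 * n) ((n : ℤ) - 1) 2 := by
  classical
  rw [← pathSum_columnWeight_oddBelow n hn, pathSum_eq_sum]
  simp only [ite_prod_columnWeight]
  rw [← Finset.sum_filter, ← finsum_mem_coe_finset]
  have hs : (↑(Finset.univ.filter fun c : Fin (n + 1) → (range (2 * n + 1)).powerset =>
      IsStateChain n (chainExtend c)) : Set (Fin (n + 1) → (range (2 * n + 1)).powerset)) =
      {c | IsStateChain n (chainExtend c)} := by
    ext c
    simp
  rw [hs]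
  refine (finsum_mem_eq_of_bijOn (g := fun A : Matrix _ _ ℤ => (X : ℤ[X]) ^ (2 * numNegLeft n A))
    _ (bijOn_chainMatrix n) fun c _ => ?_).symm
  rw [pow_mul]
end
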